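/- arXiv:1503.08575 — 3 statements merged into one kernel-verified Lean document; each statement's English description precedes it below -/
import Mathlib

section
/- Let X be a metrizable space. The hyperspace Fin(X) of nonempty finite subsets of X with the Hausdorff metric (equivalently, the Vietoris topology) is an absolute retract (AR) if and only if X is connected and locally path-connected. -/
open Set Metric Filter TopologicalSpace

/-- The hyperspace of nonempty finite subsets of a metric space `X`, equipped with
the Hausdorff metric induced by the metric of `X` (which induces the Vietoris topology). -/
def FinHyp (X : Type*) [MetricSpace X] : Type _ :=
  {A : TopologicalSpace.NonemptyCompacts X // (A : Set X).Finite}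

noncomputable instance (X : Type*) [MetricSpace X] : MetricSpace (FinHyp X) :=
  Subtype.metricSpace

/-- The underlying set of a member of the hyperspace of nonempty finite subsets. -/
def FinHyp.toSet {X : Type*} [MetricSpace X] (A : FinHyp X) : Set X := A.1

/-- A closed subset `A` of a space `Y` is a strong `Z`-set provided that for every open
cover `𝒰` of `Y` there is a continuous map `f : Y → Y` which is `𝒰`-close to the identity
and whose image has closure disjoint from `A`. -/
def IsStrongZSet {Y : Type*} [TopologicalSpace Y] (A : Set Y) : Prop :=
  IsClosed A ∧
    ∀ 𝒰 : Set (Set Y), (∀ U ∈ 𝒰, IsOpen U) → ⋃₀ 𝒰 = Set.univ →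
      ∃ f : Y → Y, Continuous f ∧ (∀ y, ∃ U ∈ 𝒰, y ∈ U ∧ f y ∈ U) ∧
        closure (Set.range f) ∩ A = ∅

universe u

/-- A metrizable space `Y` is an absolute retract (AR) if whenever `Y` is embedded as a
closed subspace of a metrizable space `Z`, there is a continuous retraction of `Z` onto
the image of `Y`. -/
def IsAR (Y : Type u) [TopologicalSpace Y] : Prop :=
  ∀ (Z : Type u) [TopologicalSpace Z] [TopologicalSpace.MetrizableSpace Z] (e : Y → Z),
    Topology.IsClosedEmbedding e →
      ∃ r : Z → Z, Continuous r ∧ Set.range r ⊆ Set.range e ∧ ∀ z ∈ Set.range e, r z = z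

namespace FinHyp

open Topology unitInterval

section Basic

variable {S X : Type*} [MetricSpace S] [MetricSpace X]

theorem finite_toSet (A : FinHyp X) : A.toSet.Finite := A.2

theorem nonempty_toSet (A : FinHyp X) : A.toSet.Nonempty := A.1.nonempty

theorem toSet_injective : Function.Injective (toSet : FinHyp X → Set X) :=
  fun _ _ h => Subtype.ext (SetLike.coe_injective h)

/-- A nonempty finite set as a point of the hyperspace. -/
def mk (s : Set X) (hs : s.Finite) (hne : s.Nonempty) : FinHyp X :=
  ⟨⟨⟨s, hs.isCompact⟩, hne⟩, hs⟩

@[simp]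
theorem toSet_mk (s : Set X) (hs : s.Finite) (hne : s.Nonempty) : (mk s hs hne).toSet = s := rfl

/-- The singleton `{x}` as a point of the hyperspace. -/
def single (x : X) : FinHyp X := mk {x} (finite_singleton x) (singleton_nonempty x)

@[simp]
theorem toSet_single (x : X) : (single x).toSet = {x} := rfl

/-- The union of the family `f` over the finite set `A`. -/
def bind (A : FinHyp S) (f : S → FinHyp X) : FinHyp X :=
  mk (⋃ x ∈ A.toSet, (f x).toSet) (A.finite_toSet.biUnion fun x _ => (f x).finite_toSet)
    (nonempty_biUnion.2 <| A.nonempty_toSet.imp fun x hx => ⟨hx, (f x).nonempty_toSet⟩)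

@[simp]
theorem toSet_bind (A : FinHyp S) (f : S → FinHyp X) :
    (A.bind f).toSet = ⋃ x ∈ A.toSet, (f x).toSet := rfl

@[simp]
theorem bind_single (x : S) (f : S → FinHyp X) : (single x).bind f = f x :=
  toSet_injective (by simp)

/-- The union of two points of the hyperspace. -/
def union (A B : FinHyp X) : FinHyp X :=
  mk (A.toSet ∪ B.toSet) (A.finite_toSet.union B.finite_toSet) (A.nonempty_toSet.inl)

@[simp]
theorem toSet_union (A B : FinHyp X) : (A.union B).toSet = A.toSet ∪ B.toSet := rfl

theorem dist_le_iff {A B : FinHyp X} {r : ℝ} (hr : 0 ≤ r) :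
    dist A B ≤ r ↔ (∀ x ∈ A.toSet, ∃ y ∈ B.toSet, dist x y ≤ r) ∧
      ∀ y ∈ B.toSet, ∃ x ∈ A.toSet, dist x y ≤ r := by
  have key : ∀ C D : FinHyp X, dist C D ≤ r → ∀ x ∈ C.toSet, ∃ y ∈ D.toSet, dist x y ≤ r := by
    intro C D h x hx
    obtain ⟨y, hy, hxy⟩ := D.finite_toSet.isCompact.exists_infDist_eq_dist D.nonempty_toSet x
    refine ⟨y, hy, hxy ▸ le_trans ?_ h⟩
    exact infDist_le_hausdorffDist_of_mem hx (hausdorffEDist_ne_top_of_nonempty_of_bounded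
      C.nonempty_toSet D.nonempty_toSet C.finite_toSet.isBounded D.finite_toSet.isBounded)
  refine ⟨fun h => ⟨key A B h, fun y hy => ?_⟩, fun ⟨h₁, h₂⟩ => ?_⟩
  · obtain ⟨x, hx, hxy⟩ := key B A (dist_comm A B ▸ h) y hy
    exact ⟨x, hx, dist_comm x y ▸ hxy⟩
  · refine hausdorffDist_le_of_mem_dist hr h₁ fun y hy => ?_
    obtain ⟨x, hx, hxy⟩ := h₂ y hy
    exact ⟨x, hx, dist_comm x y ▸ hxy⟩

theorem dist_single_le_iff {A : FinHyp X} {x : X} {r : ℝ} (hr : 0 ≤ r) :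
    dist A (single x) ≤ r ↔ ∀ y ∈ A.toSet, dist y x ≤ r := by
  rw [dist_le_iff hr]
  obtain ⟨z, hz⟩ := A.nonempty_toSet
  refine ⟨fun h y hy => by simpa using h.1 y hy, fun h => ⟨by simpa using h, ?_⟩⟩
  simpa using ⟨z, hz, h z hz⟩

theorem dist_bind_le {A : FinHyp S} {f : S → FinHyp X} {B : FinHyp X} {r : ℝ}
    (h : ∀ x ∈ A.toSet, dist (f x) B ≤ r) : dist (A.bind f) B ≤ r := by
  obtain ⟨x₀, hx₀⟩ := A.nonempty_toSet
  have hr : 0 ≤ r := dist_nonneg.trans (h x₀ hx₀)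
  rw [dist_le_iff hr]
  constructor
  · intro y hy
    simp only [toSet_bind, mem_iUnion] at hy
    obtain ⟨x, hx, hy⟩ := hy
    exact ((dist_le_iff hr).1 (h x hx)).1 y hy
  · intro y hy
    obtain ⟨z, hz, hzy⟩ := ((dist_le_iff hr).1 (h x₀ hx₀)).2 y hy
    exact ⟨z, by simpa using ⟨x₀, hx₀, hz⟩, hzy⟩

theorem isEmbedding_val : IsEmbedding fun A : FinHyp X => A.1 :=
  IsEmbedding.subtypeVal

theorem isOpen_subset {U : Set X} (hU : IsOpen U) : IsOpen {A : FinHyp X | A.toSet ⊆ U} :=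
  (NonemptyCompacts.isOpen_subsets_of_isOpen hU).preimage isEmbedding_val.continuous

theorem isOpen_inter_nonempty {U : Set X} (hU : IsOpen U) :
    IsOpen {A : FinHyp X | (A.toSet ∩ U).Nonempty} :=
  (NonemptyCompacts.isOpen_inter_nonempty_of_isOpen hU).preimage isEmbedding_val.continuous

theorem continuous_of_isOpen {T : Type*} [TopologicalSpace T] {f : T → FinHyp X}
    (h₁ : ∀ U, IsOpen U → IsOpen {t | (f t).toSet ⊆ U})
    (h₂ : ∀ U, IsOpen U → IsOpen {t | ((f t).toSet ∩ U).Nonempty}) : Continuous f := by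
  let _ := TopologicalSpace.vietoris X
  rw [isEmbedding_val.continuous_iff, NonemptyCompacts.isEmbedding_coe.continuous_iff,
    vietoris.continuous_iff]
  refine ⟨h₁, fun F hF => ⟨?_⟩⟩
  convert h₂ Fᶜ hF.isOpen_compl using 1
  ext t
  change ¬ ((f t).toSet ⊆ F) ↔ _
  rw [Set.not_subset]
  rfl

theorem continuous_single : Continuous (single : X → FinHyp X) :=
  continuous_of_isOpen (fun U hU => by simpa using hU) fun U hU => by simpa using hU

theorem continuous_union :
    Continuous fun p : FinHyp X × FinHyp X => p.1.union p.2 := by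
  refine continuous_of_isOpen (fun U hU => ?_) fun U hU => ?_
  · simp only [toSet_union, union_subset_iff]
    exact ((isOpen_subset hU).preimage continuous_fst).inter
      ((isOpen_subset hU).preimage continuous_snd)
  · simp only [toSet_union, union_inter_distrib_right, union_nonempty]
    exact ((isOpen_inter_nonempty hU).preimage continuous_fst).union
      ((isOpen_inter_nonempty hU).preimage continuous_snd)

theorem continuous_bind {T : Type*} [TopologicalSpace T] {f : T → FinHyp S}
    {g : T → S → FinHyp X} (hf : Continuous f) (hg : Continuous fun p : T × S => g p.1 p.2) :
    Continuous fun t => (f t).bind (g t) := by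
  refine continuous_of_isOpen (fun U hU => ?_) fun U hU => ?_
  · rw [isOpen_iff_mem_nhds]
    intro t₀ ht₀
    have ht₀' : ∀ x ∈ (f t₀).toSet, (g t₀ x).toSet ⊆ U := by simpa using ht₀
    obtain ⟨W, V, hW, hV, htW, hfV, hWV⟩ := generalized_tube_lemma (isCompact_singleton (x := t₀))
      (f t₀).finite_toSet.isCompact ((isOpen_subset hU).preimage hg) (by
        rintro ⟨t, x⟩ ⟨rfl, hx⟩
        exact ht₀' x hx)
    filter_upwards [hW.mem_nhds (htW rfl), ((isOpen_subset hV).preimage hf).mem_nhds hfV]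
      with t ht htV
    simp only [toSet_bind, iUnion_subset_iff]
    exact fun x hx => hWV (mk_mem_prod ht (htV hx))
  · rw [isOpen_iff_mem_nhds]
    rintro t₀ ⟨y, hy, hyU⟩
    simp only [toSet_bind, mem_iUnion] at hy
    obtain ⟨x, hx, hy⟩ := hy
    have hmem : {p : T × S | ((g p.1 p.2).toSet ∩ U).Nonempty} ∈ 𝓝 (t₀, x) :=
      ((isOpen_inter_nonempty hU).preimage hg).mem_nhds ⟨y, hy, hyU⟩
    obtain ⟨W, V, hW, htW, hV, hxV, hWV⟩ := mem_nhds_prod_iff'.1 hmem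
    filter_upwards [hW.mem_nhds htW,
      ((isOpen_inter_nonempty hV).preimage hf).mem_nhds ⟨x, hx, hxV⟩] with t ht htV
    obtain ⟨x', hx', hx'V⟩ := htV
    obtain ⟨y', hy', hy'U⟩ := hWV (mk_mem_prod ht hx'V)
    exact ⟨y', by simpa using ⟨x', hx', hy'⟩, hy'U⟩

end Basic

section Fill

variable {X : Type*} [MetricSpace X]

theorem union_self (A : FinHyp X) : A.union A = A :=
  toSet_injective (Set.union_self _)

theorem union_comm (A B : FinHyp X) : A.union B = B.union A :=
  toSet_injective (Set.union_comm _ _)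

/-- The pointwise union of two loops. -/
noncomputable def unionPath {p : FinHyp X} (g h : Path p p) : Path p p :=
  ((g.prod h).map continuous_union).cast (union_self p).symm (union_self p).symm

theorem unionPath_self {p : FinHyp X} (g : Path p p) : unionPath g g = g := by
  refine Path.ext (funext fun t => ?_)
  exact union_self (g t)

theorem unionPath_comm {p : FinHyp X} (g h : Path p p) : unionPath g h = unionPath h g := by
  refine Path.ext (funext fun t => ?_)
  exact union_comm (g t) (h t)

theorem unionPath_trans {p : FinHyp X} (g g' h h' : Path p p) :
    unionPath (g.trans g') (h.trans h') = (unionPath g h).trans (unionPath g' h') := by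
  rw [unionPath, ← Path.trans_prod_eq_prod_trans, Path.map_trans]
  rfl

theorem unionPath_homotopic {p : FinHyp X} {g g' h h' : Path p p} (hg : g.Homotopic g')
    (hh : h.Homotopic h') : (unionPath g h).Homotopic (unionPath g' h') := by
  obtain ⟨F⟩ := hg
  obtain ⟨G⟩ := hh
  exact ⟨((Path.Homotopic.prodHomotopy F G).map ⟨_, continuous_union⟩).pathCast _ _⟩

theorem homotopic_refl {p : FinHyp X} (g : Path p p) : g.Homotopic (Path.refl p) := by
  have key : ∀ h : Path p p, h.Homotopic
      ((unionPath h (Path.refl p)).trans (unionPath h (Path.refl p))) := by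
    intro h
    have h₁ := unionPath_homotopic (Path.Homotopic.Quotient.exact (p := h)
      (q := h.trans (Path.refl p)) (by simp [Path.Homotopic.Quotient.trans_refl]))
      (Path.Homotopic.Quotient.exact (p := h) (q := (Path.refl p).trans h)
        (by simp [Path.Homotopic.Quotient.refl_trans]))
    rwa [unionPath_self, unionPath_trans, unionPath_comm (Path.refl p)] at h₁
  have hq : unionPath (unionPath g (Path.refl p)) (Path.refl p) = unionPath g (Path.refl p) := by
    refine Path.ext (funext fun t => ?_)
    exact toSet_injective (show (g t).toSet ∪ p.toSet ∪ p.toSet = (g t).toSet ∪ p.toSet by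
      rw [Set.union_assoc, Set.union_self])
  have h₁ := key g
  have h₂ := key (unionPath g (Path.refl p))
  rw [hq] at h₂
  set q := unionPath g (Path.refl p)
  rw [← Path.Homotopic.Quotient.eq] at h₁ h₂ ⊢
  have h₃ := congrArg (fun z => z.trans (Path.Homotopic.Quotient.mk q).symm) h₂
  simp only [Path.Homotopic.Quotient.mk_trans, Path.Homotopic.Quotient.trans_assoc,
    Path.Homotopic.Quotient.trans_symm, Path.Homotopic.Quotient.trans_refl] at h₃
  rw [h₁, Path.Homotopic.Quotient.mk_trans, ← h₃]
  simp [Path.Homotopic.Quotient.trans_refl]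

theorem exists_circle_fill : ∃ Φ : ℝ → ℝ → FinHyp UnitAddCircle,
    (Continuous fun p : ℝ × ℝ => Φ p.1 p.2) ∧
    (∀ s ∈ Icc (0 : ℝ) 1, Φ s 0 = single (((1 + s) / 3 : ℝ) : UnitAddCircle)) ∧
    (∀ t ∈ Icc (0 : ℝ) 1, Φ 0 t = single (((1 - min 1 (2 * t)) / 3 : ℝ) : UnitAddCircle)) ∧
    (∀ t ∈ Icc (0 : ℝ) 1, Φ 1 t = single (((2 + min 1 (2 * t)) / 3 : ℝ) : UnitAddCircle)) ∧
    ∀ s, Φ s 1 = single (0 : UnitAddCircle) := by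
  let g : Path (single (0 : UnitAddCircle)) (single (0 : UnitAddCircle)) :=
    { toFun := fun s => single ((s : ℝ) : UnitAddCircle)
      continuous_toFun := continuous_single.comp
        ((AddCircle.continuous_mk' 1).comp continuous_subtype_val)
      source' := by simp
      target' := by
        congr 1
        exact AddCircle.coe_period 1 }
  obtain ⟨N⟩ := homotopic_refl g
  let P : ℝ → I := projIcc 0 1 zero_le_one
  have hP : Continuous P := continuous_projIcc
  have hP0 : ∀ s ≤ 0, P s = 0 := fun s hs => projIcc_of_le_left _ hs
  have hP1 : ∀ s, 1 ≤ s → P s = 1 := fun s hs => projIcc_of_right_le _ hs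
  let Φ : ℝ → ℝ → FinHyp UnitAddCircle := fun s t =>
    if t ≤ 1 / 2 then single (((1 - 2 * t + P s * (1 + 4 * t)) / 3 : ℝ) : UnitAddCircle)
    else N (P (2 * t - 1), P s)
  refine ⟨Φ, ?_, ?_, ?_, ?_, ?_⟩
  · refine Continuous.if_le ?_ ?_ continuous_snd continuous_const ?_
    · refine continuous_single.comp ((AddCircle.continuous_mk' 1).comp ?_)
      fun_prop
    · fun_prop
    · rintro ⟨s, t⟩ (rfl : t = 1 / 2)
      simp only [hP0 (2 * (1 / 2) - 1) (by norm_num), ContinuousMap.HomotopyWith.apply_zero]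
      change _ = single (((P s : ℝ)) : UnitAddCircle)
      congr 2
      ring
  · intro s hs
    have : (P s : ℝ) = s := congrArg Subtype.val (projIcc_of_mem _ hs)
    simp only [Φ, this]
    norm_num
  · intro t ht
    simp only [Φ, hP0 0 le_rfl]
    split_ifs with h
    · rw [min_eq_right (by linarith)]
      simp
    · rw [min_eq_left (by linarith), Path.Homotopy.source]
      simp
  · intro t ht
    simp only [Φ, hP1 1 le_rfl]
    split_ifs with h
    · rw [min_eq_right (by linarith)]
      congr 2
      norm_num
      ring
    · rw [min_eq_left (by linarith), Path.Homotopy.target]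
      congr 1
      norm_num
      exact (AddCircle.coe_period 1).symm
  · intro s
    simp only [Φ, hP1 (2 * 1 - 1) (by norm_num)]
    norm_num

end Fill

section Systems

variable {ι X Y T : Type*} [MetricSpace X]

/-- The loop running through `b` backwards, `a` and `c`, each in a third of the unit time. -/
noncomputable def triLoop (a b c : I → Y) (x : ℝ) : Y :=
  if 3 * x ≤ 1 then b (projIcc 0 1 zero_le_one (1 - 3 * x))
  else if 3 * x ≤ 2 then a (projIcc 0 1 zero_le_one (3 * x - 1))
  else c (projIcc 0 1 zero_le_one (3 * x - 2))

theorem triLoop_zero (a b c : I → Y) : triLoop a b c 0 = b 1 := by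
  simp [triLoop, projIcc_right]

theorem triLoop_one (a b c : I → Y) : triLoop a b c 1 = c 1 := by
  have h : projIcc (0 : ℝ) 1 zero_le_one (3 - 2) = 1 := projIcc_of_right_le _ (by norm_num)
  norm_num [triLoop, h]

theorem triLoop_left (a b c : I → Y) (m : I) : triLoop a b c ((1 - m) / 3) = b m := by
  have h : 3 * ((1 - m : ℝ) / 3) = 1 - m := by ring
  rw [triLoop, h, if_pos (by linarith [m.2.1]), sub_sub_cancel, projIcc_val]

theorem triLoop_middle {a b c : I → Y} (hab : a 0 = b 0) (s : I) :
    triLoop a b c ((1 + s) / 3) = a s := by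
  have h : 3 * ((1 + s : ℝ) / 3) = 1 + s := by ring
  rw [triLoop, h]
  split_ifs with h₁ h₂
  · obtain rfl : s = 0 := Subtype.ext (le_antisymm (by simpa using h₁) s.2.1)
    simp [hab]
  · rw [add_sub_cancel_left, projIcc_val]
  · exact absurd (by linarith [s.2.2]) h₂

theorem triLoop_right {a b c : I → Y} (hac : a 1 = c 0) (m : I) :
    triLoop a b c ((2 + m) / 3) = c m := by
  have h : 3 * ((2 + m : ℝ) / 3) = 2 + m := by ring
  rw [triLoop, h, if_neg (by linarith [m.2.1])]
  split_ifs with h₁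
  · obtain rfl : m = 0 := Subtype.ext (le_antisymm (by simpa using h₁) m.2.1)
    have h : projIcc (0 : ℝ) 1 zero_le_one (2 - 1) = 1 := projIcc_of_right_le _ (by norm_num)
    simp [hac, h]
  · rw [add_sub_cancel_left, projIcc_val]

theorem triLoop_mem {a b c : I → Y} {Q : Set Y} (ha : ∀ s, a s ∈ Q) (hb : ∀ s, b s ∈ Q)
    (hc : ∀ s, c s ∈ Q) (x : ℝ) : triLoop a b c x ∈ Q := by
  unfold triLoop
  split_ifs
  exacts [hb _, ha _, hc _]

theorem continuous_triLoop [TopologicalSpace T] [TopologicalSpace Y] {a b c : T → I → Y}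
    (ha : Continuous fun p : T × I => a p.1 p.2) (hb : Continuous fun p : T × I => b p.1 p.2)
    (hc : Continuous fun p : T × I => c p.1 p.2) (hab : ∀ t, a t 0 = b t 0)
    (hac : ∀ t, a t 1 = c t 0) :
    Continuous fun p : T × ℝ => triLoop (a p.1) (b p.1) (c p.1) p.2 := by
  have key : ∀ {d : T → I → Y}, (Continuous fun p : T × I => d p.1 p.2) → ∀ {u : T × ℝ → ℝ},
      Continuous u → Continuous fun p : T × ℝ => d p.1 (projIcc 0 1 zero_le_one (u p)) :=
    fun hd _ hu => hd.comp
      (continuous_fst.prodMk ((continuous_projIcc (h := zero_le_one)).comp hu))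
  have hx : Continuous fun p : T × ℝ => 3 * p.2 := by fun_prop
  refine Continuous.if_le (key hb (by fun_prop)) (Continuous.if_le (key ha (by fun_prop))
    (key hc (by fun_prop)) hx continuous_const ?_) hx continuous_const ?_
  · intro p hp
    rw [hp, projIcc_of_right_le _ (by norm_num), projIcc_of_le_left _ (by norm_num)]
    exact hac _
  · intro p hp
    rw [hp, if_pos (by norm_num), projIcc_of_le_left _ (by norm_num)]
    exact (hab _).symm

/-- The function induced by `triLoop` on the circle. -/
noncomputable def circleLoop (a b c : I → Y) (z : UnitAddCircle) : Y :=
  triLoop a b c (AddCircle.equivIco 1 0 z)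

theorem circleLoop_coe {a b c : I → Y} (hbc : b 1 = c 1) {x : ℝ} (hx : x ∈ Icc (0 : ℝ) 1) :
    circleLoop a b c (x : UnitAddCircle) = triLoop a b c x := by
  rw [circleLoop, AddCircle.coe_equivIco_mk_apply]
  rcases hx.2.lt_or_eq with h | rfl
  · rw [div_one, mul_one, Int.fract_eq_self.2 ⟨hx.1, h⟩]
  · simp [triLoop_zero, triLoop_one, hbc]

theorem continuous_circleLoop [TopologicalSpace T] [TopologicalSpace Y] {a b c : T → I → Y}
    (ha : Continuous fun p : T × I => a p.1 p.2) (hb : Continuous fun p : T × I => b p.1 p.2)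
    (hc : Continuous fun p : T × I => c p.1 p.2) (hab : ∀ t, a t 0 = b t 0)
    (hac : ∀ t, a t 1 = c t 0) (hbc : ∀ t, b t 1 = c t 1) :
    Continuous fun p : T × UnitAddCircle => circleLoop (a p.1) (b p.1) (c p.1) p.2 := by
  rw [← (IsOpenQuotientMap.id.prodMap
    (QuotientAddGroup.isOpenQuotientMap_mk (N := AddSubgroup.zmultiples (1 : ℝ)))).continuous_comp_iff]
  convert ContinuousOn.comp_fract' (f := fun t x => triLoop (a t) (b t) (c t) x)
    (continuous_triLoop ha hb hc hab hac).continuousOn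
    (fun t => by rw [triLoop_zero, triLoop_one, hbc]) using 2 with p
  change triLoop _ _ _ (AddCircle.equivIco 1 0 ((p.2 : ℝ) : UnitAddCircle) : ℝ) = _
  rw [AddCircle.coe_equivIco_mk_apply]
  simp

/-- A filling of the circle by its hyperspace. -/
noncomputable def circleFill : ℝ → ℝ → FinHyp UnitAddCircle := exists_circle_fill.choose

/-- A family of points of the hyperspace with paths between any two of them. -/
@[ext]
structure PathSystem (ι X : Type*) [MetricSpace X] where
  /-- The points of the system. -/
  pt : ι → FinHyp X
  /-- The paths of the system. -/
  path : ι → ι → I → FinHyp X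
  path_zero : ∀ i j, path i j 0 = pt i
  path_one : ∀ i j, path i j 1 = pt j

namespace PathSystem

/-- Move all points of the system towards the point with index `k`, at time `t`. -/
noncomputable def step (S : PathSystem ι X) (k : ι) (t : I) : PathSystem ι X where
  pt i := S.path i k (projIcc 0 1 zero_le_one (2 * t))
  path i j s := (circleFill s t).bind (circleLoop (S.path i j) (S.path i k) (S.path j k))
  path_zero i j := by
    have h := exists_circle_fill.choose_spec.2.2.1 t t.2
    have hm : min 1 (2 * (t : ℝ)) = (projIcc 0 1 zero_le_one (2 * (t : ℝ)) : I) := by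
      rw [coe_projIcc, max_eq_right (le_min zero_le_one (by linarith [t.2.1]))]
    rw [hm] at h
    have hm' := (projIcc (0 : ℝ) 1 zero_le_one (2 * (t : ℝ))).2
    change (circleFill 0 t).bind _ = _
    rw [circleFill, h, bind_single, circleLoop_coe (by simp [S.path_one]), triLoop_left]
    constructor <;> linarith [hm'.1, hm'.2]
  path_one i j := by
    have h := exists_circle_fill.choose_spec.2.2.2.1 t t.2
    have hm : min 1 (2 * (t : ℝ)) = (projIcc 0 1 zero_le_one (2 * (t : ℝ)) : I) := by
      rw [coe_projIcc, max_eq_right (le_min zero_le_one (by linarith [t.2.1]))]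
    rw [hm] at h
    have hm' := (projIcc (0 : ℝ) 1 zero_le_one (2 * (t : ℝ))).2
    change (circleFill 1 t).bind _ = _
    rw [circleFill, h, bind_single, circleLoop_coe (by simp [S.path_one]),
      triLoop_right (by simp [S.path_one, S.path_zero])]
    constructor <;> linarith [hm'.1, hm'.2]

theorem step_zero (S : PathSystem ι X) (k : ι) : S.step k 0 = S := by
  refine PathSystem.ext (funext fun i => ?_) (funext fun i => funext fun j => funext fun s => ?_)
  · simp [step, S.path_zero]
  · have h := exists_circle_fill.choose_spec.2.1 s s.2
    change (circleFill s 0).bind _ = _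
    rw [circleFill, h, bind_single, circleLoop_coe (by simp [S.path_one]),
      triLoop_middle (by simp [S.path_zero])]
    constructor <;> linarith [s.2.1, s.2.2]

theorem step_one_pt (S : PathSystem ι X) (k i : ι) : (S.step k 1).pt i = S.pt k := by
  have h : projIcc (0 : ℝ) 1 zero_le_one (2 * ((1 : I) : ℝ)) = 1 :=
    projIcc_of_right_le _ (by norm_num)
  simp only [step, h, S.path_one]

theorem step_one_path (S : PathSystem ι X) (k i j : ι) (s : I) :
    (S.step k 1).path i j s = S.pt k := by
  have h := exists_circle_fill.choose_spec.2.2.2.2 s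
  change (circleFill s 1).bind _ = _
  rw [circleFill, h, bind_single, ← QuotientAddGroup.mk_zero,
    circleLoop_coe (by simp [S.path_one]) (by simp), triLoop_zero, S.path_one]

/-- A family of path systems is continuous if all its points and paths are. -/
structure ContFamily [TopologicalSpace T] (S : T → PathSystem ι X) : Prop where
  pt : ∀ i, Continuous fun t => (S t).pt i
  path : ∀ i j, Continuous fun p : T × I => (S p.1).path i j p.2

theorem ContFamily.const [TopologicalSpace T] (S : PathSystem ι X)
    (h : ∀ i j, Continuous (S.path i j)) : ContFamily fun _ : T => S :=
  ⟨fun _ => continuous_const, fun i j => (h i j).comp continuous_snd⟩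

theorem ContFamily.step [TopologicalSpace T] {S : T → PathSystem ι X} (hS : ContFamily S)
    (k : ι) {τ : T → I} (hτ : Continuous τ) : ContFamily fun t => (S t).step k (τ t) where
  pt i := (hS.path i k).comp (continuous_id.prodMk
    ((continuous_projIcc (h := zero_le_one)).comp (by fun_prop)))
  path i j := by
    refine continuous_bind (exists_circle_fill.choose_spec.1.comp
      (g := fun p : ℝ × ℝ => circleFill p.1 p.2) (f := fun p : T × I => ((p.2 : ℝ), (τ p.1 : ℝ)))
      (by fun_prop)) ?_
    have h := continuous_circleLoop (a := fun t => (S t).path i j) (b := fun t => (S t).path i k)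
      (c := fun t => (S t).path j k) (hS.path i j) (hS.path i k) (hS.path j k)
      (fun t => by rw [(S t).path_zero, (S t).path_zero])
      (fun t => by rw [(S t).path_zero, (S t).path_one])
      (fun t => by rw [(S t).path_one, (S t).path_one])
    exact h.comp (f := fun p : (T × I) × UnitAddCircle => (p.1.1, p.2)) (by fun_prop)

/-- Apply the steps given by a list of indices successively. -/
noncomputable def run (S : PathSystem ι X) (τ : ι → I) (L : List ι) : PathSystem ι X :=
  L.foldl (fun S k => S.step k (τ k)) S

theorem run_filter (S : PathSystem ι X) (τ : ι → I) (p : ι → Bool) (L : List ι)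
    (hp : ∀ k, p k = false → τ k = 0) : S.run τ (L.filter p) = S.run τ L := by
  induction L generalizing S with
  | nil => rfl
  | cons k L ih =>
    by_cases h : p k = true
    · rw [List.filter_cons_of_pos h]
      exact ih _
    · rw [List.filter_cons_of_neg h, ih]
      simp only [run, List.foldl_cons, hp k (by simpa using h), step_zero]

theorem ContFamily.run [TopologicalSpace T] {S : T → PathSystem ι X} (hS : ContFamily S)
    {τ : ι → T → I} (hτ : ∀ k, Continuous (τ k)) (L : List ι) :
    ContFamily fun t => (S t).run (fun k => τ k t) L := by
  induction L generalizing S with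
  | nil => exact hS
  | cons k L ih => exact ih (hS.step k (hτ k))

/-- The points and paths of the system with indices in `J` lie in `Q`. -/
structure Within (S : PathSystem ι X) (J : Set ι) (Q : Set (FinHyp X)) : Prop where
  pt : ∀ i ∈ J, S.pt i ∈ Q
  path : ∀ i ∈ J, ∀ j ∈ J, ∀ s, S.path i j s ∈ Q

variable {S : PathSystem ι X} {J : Set ι} {Q : Set (FinHyp X)}

theorem Within.step (hS : S.Within J Q) (hQ : ∀ (A : FinHyp UnitAddCircle)
    (f : UnitAddCircle → FinHyp X), (∀ z, f z ∈ Q) → A.bind f ∈ Q) {k : ι} (hk : k ∈ J) (t : I) :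
    (S.step k t).Within J Q where
  pt i hi := hS.path i hi k hk _
  path i hi j hj _ := hQ _ _ fun _ => triLoop_mem (hS.path i hi j hj) (hS.path i hi k hk)
    (hS.path j hj k hk) _

theorem Within.run (hS : S.Within J Q) (hQ : ∀ (A : FinHyp UnitAddCircle)
    (f : UnitAddCircle → FinHyp X), (∀ z, f z ∈ Q) → A.bind f ∈ Q) (τ : ι → I) {L : List ι}
    (hL : ∀ k ∈ L, k ∈ J) : (S.run τ L).Within J Q := by
  induction L generalizing S with
  | nil => exact hS
  | cons k L ih =>
    simp only [List.mem_cons, forall_eq_or_imp] at hL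
    exact ih (hS.step hQ hL.1 _) hL.2

theorem Within.run_univ (hS : S.Within J Q) (hQ : ∀ (A : FinHyp UnitAddCircle)
    (f : UnitAddCircle → FinHyp X), (∀ z, f z ∈ Q) → A.bind f ∈ Q) (τ : ι → I) {L : List ι}
    (hL : ∀ k ∈ L, k ∈ J) (h₁ : ∃ k ∈ L, τ k = 1) : (S.run τ L).Within univ Q := by
  induction L generalizing S with
  | nil => simp at h₁
  | cons k L ih =>
    simp only [List.mem_cons, forall_eq_or_imp] at hL
    by_cases h : τ k = 1
    · refine Within.run (S := S.step k (τ k)) ⟨fun i _ => ?_, fun i _ j _ s => ?_⟩ hQ τ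
        fun _ _ => mem_univ _
      · rw [h, step_one_pt]
        exact hS.pt k hL.1
      · rw [h, step_one_path]
        exact hS.pt k hL.1
    · refine ih (hS.step hQ hL.1 (τ k)) hL.2 ?_
      simpa [h] using h₁

end PathSystem

end Systems

section Paths

variable {X : Type*} [MetricSpace X]

theorem exists_path_of_range {κ : Type*} [Finite κ] {a b : κ → X} (γ : ∀ k, Path (a k) (b k))
    {A B : FinHyp X} (hA : range a = A.toSet) (hB : range b = B.toSet) :
    ∃ p : Path A B, ∀ t, (p t).toSet = range fun k => γ k t := by
  have hne : Nonempty κ := by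
    rw [← range_nonempty_iff_nonempty (f := a), hA]
    exact A.nonempty_toSet
  refine ⟨⟨⟨fun t => mk (range fun k => γ k t) (finite_range _) (range_nonempty _),
    continuous_of_isOpen (fun U hU => ?_) fun U hU => ?_⟩, toSet_injective ?_,
    toSet_injective ?_⟩, fun t => rfl⟩
  · simp only [toSet_mk, range_subset_iff, ofPred_forall]
    exact isOpen_iInter_of_finite fun k => hU.preimage (γ k).continuous
  · convert isOpen_iUnion fun k => hU.preimage (γ k).continuous using 1
    ext t
    simp [Set.Nonempty]
  · simp [hA]
  · simp [hB]

theorem exists_path [PathConnectedSpace X] (A B : FinHyp X) : Nonempty (Path A B) := by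
  have := A.finite_toSet.to_subtype
  have := B.finite_toSet.to_subtype
  have := A.nonempty_toSet.to_subtype
  have := B.nonempty_toSet.to_subtype
  obtain ⟨p, -⟩ := exists_path_of_range
    (fun k : A.toSet × B.toSet => PathConnectedSpace.somePath (k.1 : X) (k.2 : X))
    (A := A) (B := B) (by rw [range_comp' Subtype.val Prod.fst]; simp) (by
      rw [range_comp' Subtype.val Prod.snd]; simp)
  exact ⟨p⟩

theorem exists_small_path [LocallyPathConnectedSpace X] (C : FinHyp X) {ε : ℝ} (hε : 0 < ε) :
    ∀ᶠ G in (𝓝 C).smallSets, ∀ A ∈ G, ∀ B ∈ G, ∃ p : Path A B, ∀ t, dist (p t) C ≤ ε := by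
  let V : X → Set X := fun c => pathComponentIn (ball c ε) c
  have hV : ∀ c, IsOpen (V c) := fun c => isOpen_ball.pathComponentIn c
  have hmem : ∀ c, c ∈ V c := fun c => mem_pathComponentIn_self (mem_ball_self hε)
  have hG : {A : FinHyp X | A.toSet ⊆ ⋃ c ∈ C.toSet, V c} ∩
      ⋂ c ∈ C.toSet, {A : FinHyp X | (A.toSet ∩ V c).Nonempty} ∈ 𝓝 C := by
    refine IsOpen.mem_nhds ((isOpen_subset (isOpen_biUnion fun c _ => hV c)).inter
      (C.finite_toSet.isOpen_biInter fun c _ => isOpen_inter_nonempty (hV c))) ⟨?_, ?_⟩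
    · exact fun c hc => mem_biUnion hc (hmem c)
    · exact mem_iInter₂.2 fun c hc => ⟨c, hc, hmem c⟩
  rw [eventually_smallSets]
  refine ⟨_, hG, fun G hGG A hA B hB => ?_⟩
  obtain ⟨hA₁, hA₂⟩ := hGG hA
  obtain ⟨hB₁, hB₂⟩ := hGG hB
  rw [mem_iInter₂] at hA₂ hB₂
  let κ := {k : X × X × X // (k.1 ∈ A.toSet ∧ k.2.1 ∈ B.toSet ∧ k.2.2 ∈ C.toSet) ∧
    k.1 ∈ V k.2.2 ∧ k.2.1 ∈ V k.2.2}
  have hκ : Finite κ := ((A.finite_toSet.prod (B.finite_toSet.prod C.finite_toSet)).subset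
    fun k hk => hk.1).to_subtype
  have hj : ∀ k : κ, JoinedIn (ball k.1.2.2 ε) k.1.1 k.1.2.1 :=
    fun k => k.2.2.1.symm.trans k.2.2.2
  choose γ hγ using hj
  obtain ⟨p, hp⟩ := exists_path_of_range γ (A := A) (B := B) (by
    ext a
    constructor
    · rintro ⟨k, rfl⟩
      exact k.2.1.1
    · intro ha
      obtain ⟨c, hc, hac⟩ := mem_iUnion₂.1 (hA₁ ha)
      obtain ⟨b, hb, hbc⟩ := hB₂ c hc
      exact ⟨⟨(a, b, c), ⟨ha, hb, hc⟩, hac, hbc⟩, rfl⟩) (by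
    ext b
    constructor
    · rintro ⟨k, rfl⟩
      exact k.2.1.2.1
    · intro hb
      obtain ⟨c, hc, hbc⟩ := mem_iUnion₂.1 (hB₁ hb)
      obtain ⟨a, ha, hac⟩ := hA₂ c hc
      exact ⟨⟨(a, b, c), ⟨ha, hb, hc⟩, hac, hbc⟩, rfl⟩)
  refine ⟨p, fun t => ?_⟩
  rw [dist_le_iff hε.le, hp]
  constructor
  · rintro _ ⟨k, rfl⟩
    exact ⟨k.1.2.2, k.2.1.2.2, (hγ k t).le⟩
  · intro c hc
    obtain ⟨a, ha, hac⟩ := hA₂ c hc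
    obtain ⟨b, hb, hbc⟩ := hB₂ c hc
    let k : κ := ⟨(a, b, c), ⟨ha, hb, hc⟩, hac, hbc⟩
    exact ⟨_, ⟨k, rfl⟩, (hγ k t).le⟩

theorem exists_nearly_shortest_path [PathConnectedSpace X] (A B : FinHyp X) :
    ∃ p : Path A B, ∀ (q : Path A B) (r : ℝ), (∀ s, dist A (q s) ≤ r) →
      ∀ s, dist A (p s) ≤ r + dist A B := by
  rcases eq_or_ne A B with rfl | hAB
  · exact ⟨Path.refl A, fun q r hr s => by simpa using dist_nonneg.trans (hr s)⟩
  · let R : Set ℝ := {r | ∃ q : Path A B, ∀ s, dist A (q s) ≤ r}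
    have hR : R.Nonempty := by
      obtain ⟨q⟩ := exists_path A B
      obtain ⟨r, hr⟩ := (isCompact_range
        (f := fun s => dist A (q s)) (by fun_prop)).bddAbove
      exact ⟨r, q, fun s => hr ⟨s, rfl⟩⟩
    have hR₀ : BddBelow R := ⟨0, fun r ⟨q, hq⟩ => dist_nonneg.trans (hq 0)⟩
    obtain ⟨r, ⟨p, hp⟩, hr⟩ := Real.lt_sInf_add_pos hR (dist_pos.2 hAB)
    exact ⟨p, fun q r' hr' s => (hp s).trans (hr.le.trans
      (add_le_add_left (csInf_le hR₀ ⟨q, hr'⟩) _))⟩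

theorem exists_path_system [PathConnectedSpace X] [LocallyPathConnectedSpace X] :
    ∃ S : PathSystem (FinHyp X) X, (∀ A B, Continuous (S.path A B)) ∧
      ∀ C : FinHyp X, ∀ ε > 0, ∃ δ > 0, ∀ A ∈ ball C δ, ∀ B ∈ ball C δ, ∀ s,
        S.path A B s ∈ closedBall C ε := by
  choose p hp using fun A B : FinHyp X => exists_nearly_shortest_path A B
  refine ⟨⟨id, fun A B => p A B, fun A B => (p A B).source, fun A B => (p A B).target⟩,
    fun A B => (p A B).continuous, fun C ε hε => ?_⟩
  obtain ⟨G, hG, hG'⟩ := eventually_smallSets.1 (exists_small_path C (ε := ε / 8) (by positivity))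
  obtain ⟨δ, hδ, hδG⟩ := Metric.mem_nhds_iff.1 hG
  refine ⟨min δ (ε / 8), by positivity, fun A hA B hB s => ?_⟩
  rw [mem_ball, lt_min_iff] at hA hB
  obtain ⟨q, hq⟩ := hG' G subset_rfl A (hδG hA.1) B (hδG hB.1)
  have h := hp A B q (ε / 4) (fun s => by
    linarith [dist_triangle_right A (q s) C, hq s]) s
  change dist (p A B s) C ≤ ε
  linarith [dist_triangle_left (p A B s) C A, dist_triangle_right A B C]

end Paths

section AbsoluteRetract

variable {X : Type u} [MetricSpace X]

/-- Reindex a path system. -/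
def PathSystem.comap {ι κ : Type*} (S : PathSystem ι X) (f : κ → ι) : PathSystem κ X where
  pt i := S.pt (f i)
  path i j := S.path (f i) (f j)
  path_zero _ _ := S.path_zero _ _
  path_one _ _ := S.path_one _ _

theorem sort_eq_filter_sort {ι : Type*} [LinearOrder ι] {s t : Finset ι} (h : s ⊆ t) :
    s.sort = t.sort.filter (· ∈ s) := by
  refine List.Perm.eq_of_sortedLE (s.pairwise_sort _).sortedLE
    ((t.pairwise_sort _).filter _).sortedLE ((List.perm_ext_iff_of_nodup (s.sort_nodup _)
      ((t.sort_nodup _).filter _)).2 fun k => ?_)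
  simpa using fun hk => h hk

/-- Given a path system and a locally finite family of functions to the unit interval,
run the system at each point along the indices active at that point. -/
theorem PathSystem.exists_continuous_run {ι Z : Type*} [TopologicalSpace Z]
    (S : PathSystem ι X) (hS : ∀ i j, Continuous (S.path i j)) (i₀ : ι) {τ : ι → Z → I}
    (hτ : ∀ k, Continuous (τ k)) (hfin : LocallyFinite fun k => {z | τ k z ≠ 0})
    (hone : ∀ z, ∃ k, τ k z = 1) :
    ∃ F : Z → FinHyp X, Continuous F ∧ ∀ z (C : FinHyp X) (r : ℝ),
      S.Within {k | τ k z ≠ 0} (closedBall C r) → F z ∈ closedBall C r := by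
  classical
  let _ : LinearOrder ι := linearOrderOfSTO WellOrderingRel
  let act : Z → Finset ι := fun z => (hfin.point_finite z).toFinset
  have hact : ∀ z k, k ∈ act z ↔ τ k z ≠ 0 := fun z k => by simp [act]
  refine ⟨fun z => (S.run (fun k => τ k z) (act z).sort).pt i₀, ?_, fun z C r hC => ?_⟩
  · rw [continuous_iff_continuousAt]
    intro z₀
    obtain ⟨N, hN, hfN⟩ := hfin z₀
    have hJ : ∀ z ∈ N, act z ⊆ hfN.toFinset := fun z hz k hk => by
      simpa using ⟨z, (hact z k).1 hk, hz⟩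
    refine ((((ContFamily.const S hS).run hτ hfN.toFinset.sort).pt i₀).continuousAt
      (x := z₀)).congr ?_
    filter_upwards [hN] with z hz
    rw [sort_eq_filter_sort (hJ z hz), run_filter]
    intro k hk
    by_contra hne
    simp [hact, hne] at hk
  · have hmem : ∀ k ∈ (act z).sort, k ∈ {k | τ k z ≠ 0} := fun k hk => by
      simpa [hact] using hk
    obtain ⟨k, hk⟩ := hone z
    refine (hC.run_univ (fun A f hf => ?_) (fun k => τ k z) hmem ⟨k, ?_, hk⟩).pt i₀ (mem_univ _)
    · exact dist_bind_le fun x _ => hf x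
    · simp [hact, hk]

theorem isAR [ConnectedSpace X] [LocallyPathConnectedSpace X] : IsAR (FinHyp X) := by
  intro Z _ _ e he
  classical
  let _ : MetricSpace Z := metrizableSpaceMetric Z
  have : PathConnectedSpace X := pathConnectedSpace_iff_connectedSpace.2 inferInstance
  obtain ⟨x₀⟩ : Nonempty X := inferInstance
  obtain ⟨S, hSc, hS⟩ := exists_path_system (X := X)
  let K := range e
  have hK : IsClosed K := he.isClosed_range
  have hKne : K.Nonempty := ⟨_, single x₀, rfl⟩
  let Z' := {z : Z // z ∉ K}
  let ρ : Z' → ℝ := fun z => infDist (z : Z) K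
  have hρ : ∀ z, 0 < ρ z := fun z => (hK.notMem_iff_infDist_pos hKne).1 z.2
  have hA : ∀ z : Z', ∃ A : FinHyp X, dist (z : Z) (e A) < 2 * ρ z := fun z => by
    obtain ⟨_, ⟨A, rfl⟩, h⟩ := (infDist_lt_iff hKne).1 (show ρ z < 2 * ρ z by linarith [hρ z])
    exact ⟨A, h⟩
  choose A hA using hA
  obtain ⟨f, hf⟩ := BumpCovering.exists_isSubordinate (X := Z') isClosed_univ
    (fun z : Z' => ball z (ρ z / 4)) (fun _ => isOpen_ball)
    (fun z _ => mem_iUnion.2 ⟨z, mem_ball_self (by linarith [hρ z])⟩)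
  let τ : Z' → Z' → I := fun k z => ⟨f k z, f.nonneg k z, f.le_one k z⟩
  have hτ0 : ∀ k z, τ k z ≠ 0 ↔ f k z ≠ 0 := fun k z => by
    simp [τ, Subtype.ext_iff]
  rcases isEmpty_or_nonempty Z' with hZ | ⟨⟨i₀⟩⟩
  · refine ⟨id, continuous_id, fun z _ => ?_, fun _ _ => rfl⟩
    by_contra h
    exact hZ.false ⟨z, h⟩
  obtain ⟨F, hF, hFC⟩ := (S.comap A).exists_continuous_run (fun i j => hSc _ _) i₀ (τ := τ)
    (fun k => (f k).continuous.subtype_mk _)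
    (by
      convert f.locallyFinite using 2 with k
      ext z
      exact hτ0 k z)
    (fun z => ⟨f.ind z (mem_univ _), Subtype.ext (f.ind_apply z (mem_univ _))⟩)
  refine ⟨fun z => if h : z ∈ K then z else e (F ⟨z, h⟩), ?_, ?_, fun z hz => dif_pos hz⟩
  · rw [continuous_iff_continuousAt]
    intro z₀
    by_cases hz₀ : z₀ ∈ K
    · obtain ⟨y₀, rfl⟩ := hz₀
      rw [ContinuousAt, dif_pos ⟨y₀, rfl⟩]
      intro W hW
      obtain ⟨ε, hε, hεW⟩ := Metric.nhds_basis_closedBall.mem_iff.1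
        (he.continuous.continuousAt.preimage_mem_nhds hW)
      obtain ⟨δ, hδ, hSδ⟩ := hS y₀ ε hε
      have hδ' := he.isInducing.nhds_eq_comap y₀ ▸ ball_mem_nhds y₀ hδ
      obtain ⟨η, hη, hηδ⟩ := (Metric.nhds_basis_ball.comap e).mem_iff.1 hδ'
      rw [mem_map]
      filter_upwards [hW, ball_mem_nhds (e y₀) (show 0 < η / 4 by positivity)] with z hzW hz
      by_cases hzK : z ∈ K
      · simpa [hzK] using hzW
      · simp only [mem_preimage, hzK, dite_false]
        refine hεW (hFC ⟨z, hzK⟩ y₀ ε ?_)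
        have hAδ : ∀ k ∈ {k | τ k ⟨z, hzK⟩ ≠ 0}, A k ∈ ball y₀ δ := by
          intro k hk
          have h₁ : dist z k < ρ k / 4 :=
            hf k (subset_tsupport _ ((hτ0 k _).1 hk))
          have h₂ : ρ k ≤ dist (k : Z) (e y₀) := infDist_le_dist_of_mem ⟨y₀, rfl⟩
          refine hηδ (mem_ball.2 ?_)
          have h₃ := dist_triangle (k : Z) z (e y₀)
          have h₄ := dist_triangle_left (e (A k)) (e y₀) (k : Z)
          rw [dist_comm (k : Z) z] at h₃
          linarith [mem_ball.1 hz, hA k]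
        refine ⟨fun i hi => ?_, fun i hi j hj s => hSδ _ (hAδ i hi) _ (hAδ j hj) s⟩
        have := hSδ _ (hAδ i hi) _ (hAδ i hi) 0
        rwa [S.path_zero] at this
    · have : ContinuousOn (fun z => if h : z ∈ K then z else e (F ⟨z, h⟩)) Kᶜ := by
        rw [continuousOn_iff_continuous_domRestrict]
        refine (he.continuous.comp hF).congr fun z => ?_
        exact (dif_neg (t := fun h => (z : Z)) (e := fun h => e (F ⟨z, h⟩)) z.2).symm
      exact this.continuousAt (hK.isOpen_compl.mem_nhds hz₀)
  · rintro _ ⟨z, rfl⟩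
    beta_reduce
    by_cases hz : z ∈ K
    · rwa [dif_pos hz]
    · rw [dif_neg hz]
      exact ⟨_, rfl⟩

end AbsoluteRetract

end FinHyp

theorem IsAR.nonempty {Y : Type u} [TopologicalSpace Y] (h : IsAR Y) : Nonempty Y := by
  by_contra hY
  rw [not_nonempty_iff] at hY
  have he : Topology.IsClosedEmbedding (fun _ : Y => PUnit.unit.{u + 1}) :=
    .of_continuous_injective_isClosedMap continuous_const (Function.injective_of_subsingleton _)
      fun s _ => by simp [Set.eq_empty_of_isEmpty s]
  obtain ⟨r, -, hr, -⟩ := h PUnit _ he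
  obtain ⟨y, -⟩ := hr ⟨PUnit.unit, rfl⟩
  exact hY.false y

section KuratowskiHull

open scoped BoundedContinuousFunction

variable {Y : Type u} [MetricSpace Y]

/-- The Kuratowski embedding with base point `y₀`. -/
noncomputable def kuratowski (y₀ y : Y) : Y →ᵇ ℝ :=
  BoundedContinuousFunction.ofNormedAddCommGroup (fun z => dist y z - dist y₀ z) (by fun_prop)
    (dist y y₀) fun z => by
      rw [Real.norm_eq_abs]
      exact abs_dist_sub_le y y₀ z

theorem kuratowski_apply (y₀ y z : Y) : kuratowski y₀ y z = dist y z - dist y₀ z := rfl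

theorem isometry_kuratowski (y₀ : Y) : Isometry (kuratowski y₀) := by
  refine Isometry.of_dist_eq fun x y => le_antisymm ?_ ?_
  · refine (BoundedContinuousFunction.dist_le dist_nonneg).2 fun z => ?_
    rw [kuratowski_apply, kuratowski_apply, dist_sub_right, Real.dist_eq]
    exact abs_dist_sub_le x y z
  · have h := BoundedContinuousFunction.dist_coe_le_dist (f := kuratowski y₀ x)
      (g := kuratowski y₀ y) y
    rw [kuratowski_apply, kuratowski_apply, dist_sub_right, Real.dist_eq, dist_self, sub_zero,
      abs_dist] at h
    exact h

theorem exists_mul_dist_le_of_mem_convexHull {y₀ : Y} {g : Y →ᵇ ℝ}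
    (hg : g ∈ convexHull ℝ (range (kuratowski y₀))) :
    ∃ c > 0, ∃ y, ∀ z, c * dist y z ≤ g z + dist y₀ z := by
  refine convexHull_min (t := {g | ∃ c > 0, ∃ y, ∀ z, c * dist y z ≤ g z + dist y₀ z}) ?_ ?_ hg
  · rintro _ ⟨y, rfl⟩
    exact ⟨1, one_pos, y, fun z => by simp [kuratowski_apply]⟩
  · rintro g ⟨c, hc, y, hy⟩ g' ⟨c', hc', y', hy'⟩ a b ha hb hab
    rcases ha.eq_or_lt with rfl | ha
    · obtain rfl : b = 1 := by simpa using hab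
      exact ⟨c', hc', y', fun z => by simpa using hy' z⟩
    · refine ⟨a * c, mul_pos ha hc, y, fun z => ?_⟩
      have h₁ := mul_le_mul_of_nonneg_left (hy z) ha.le
      have h₂ : 0 ≤ b * (g' z + dist y₀ z) :=
        mul_nonneg hb ((mul_nonneg hc'.le dist_nonneg).trans (hy' z))
      have h₃ : dist y₀ z = a * dist y₀ z + b * dist y₀ z := by rw [← add_mul, hab, one_mul]
      simp only [BoundedContinuousFunction.coe_add, BoundedContinuousFunction.coe_smul,
        Pi.add_apply, smul_eq_mul]
      linarith

theorem mem_range_of_mem_convexHull_of_mem_closure {y₀ : Y} {g : Y →ᵇ ℝ}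
    (hg : g ∈ convexHull ℝ (range (kuratowski y₀))) (hg' : g ∈ closure (range (kuratowski y₀))) :
    g ∈ range (kuratowski y₀) := by
  obtain ⟨c, hc, y, hy⟩ := exists_mul_dist_le_of_mem_convexHull hg
  refine ⟨y, dist_le_zero.1 (le_of_forall_pos_le_add fun ε hε => ?_)⟩
  obtain ⟨_, ⟨y', rfl⟩, h⟩ := Metric.mem_closure_iff.1 hg' (min (ε / 2) (c * (ε / 2)))
    (by positivity)
  rw [lt_min_iff] at h
  have h₁ := (BoundedContinuousFunction.dist_coe_le_dist (f := g) (g := kuratowski y₀ y') y')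
  rw [Real.dist_eq, kuratowski_apply, dist_self, zero_sub, sub_neg_eq_add] at h₁
  have h₂ : dist y y' < ε / 2 := lt_of_mul_lt_mul_left
    (((hy y').trans (le_abs_self _)).trans_lt (h₁.trans_lt h.2)) hc.le
  have h₃ := dist_triangle_right (kuratowski y₀ y) g (kuratowski y₀ y')
  rw [(isometry_kuratowski y₀).dist_eq] at h₃
  linarith [h.1]

theorem IsAR.exists_path (h : IsAR Y) : (∀ x y : Y, Nonempty (Path x y)) ∧
    ∀ x : Y, ∀ ε > 0, ∃ δ > 0, ∀ y, dist y x < δ → ∃ p : Path x y, ∀ t, dist (p t) x < ε := by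
  obtain ⟨y₀⟩ := h.nonempty
  let H : Set (Y →ᵇ ℝ) := convexHull ℝ (range (kuratowski y₀))
  have hmem : ∀ y, kuratowski y₀ y ∈ H := fun y => subset_convexHull ℝ _ ⟨y, rfl⟩
  let e : Y → H := fun y => ⟨kuratowski y₀ y, hmem y⟩
  have hiso : Isometry e := fun x y => isometry_kuratowski y₀ x y
  have he : Topology.IsClosedEmbedding e := by
    refine ⟨hiso.isEmbedding, isClosed_of_closure_subset fun z hz => ?_⟩
    obtain ⟨y, hy⟩ := mem_range_of_mem_convexHull_of_mem_closure z.2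
      (map_mem_closure continuous_subtype_val hz (by
        rintro _ ⟨y, rfl⟩
        exact ⟨y, rfl⟩))
    exact ⟨y, Subtype.ext hy⟩
  obtain ⟨r, hr, hre, hfix⟩ := h H e he
  choose ρ hρ using fun z => hre ⟨z, rfl⟩
  have hρe : ∀ y, ρ (e y) = y := fun y => hiso.injective ((hρ _).trans (hfix _ ⟨y, rfl⟩))
  have hρc : Continuous ρ := by
    rw [hiso.isEmbedding.continuous_iff]
    exact hr.congr fun z => (hρ z).symm
  let seg : ∀ x y : Y, unitInterval → H := fun x y t =>
    ⟨AffineMap.lineMap (kuratowski y₀ x) (kuratowski y₀ y) (t : ℝ),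
      (convex_convexHull ℝ _).lineMap_mem (hmem x) (hmem y) t.2⟩
  let P : ∀ x y : Y, Path x y := fun x y =>
    { toFun := fun t => ρ (seg x y t)
      continuous_toFun := hρc.comp (Continuous.subtype_mk
        (AffineMap.lineMap_continuous.comp continuous_subtype_val) _)
      source' := by
        rw [show seg x y 0 = e x from Subtype.ext (by simp [seg, e]), hρe]
      target' := by
        rw [show seg x y 1 = e y from Subtype.ext (by simp [seg, e]), hρe] }
  refine ⟨fun x y => ⟨P x y⟩, fun x ε hε => ?_⟩
  obtain ⟨δ, hδ, hδρ⟩ := Metric.continuousAt_iff.1 (hρc.continuousAt (x := e x)) ε hε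
  refine ⟨δ, hδ, fun y hy => ⟨P x y, fun t => ?_⟩⟩
  have h₁ : dist (seg x y t) (e x) < δ := by
    change dist (AffineMap.lineMap (kuratowski y₀ x) (kuratowski y₀ y) (t : ℝ)) _ < δ
    rw [dist_lineMap_left, (isometry_kuratowski y₀).dist_eq, Real.norm_of_nonneg t.2.1, dist_comm]
    exact (mul_le_of_le_one_left dist_nonneg t.2.2).trans_lt hy
  have h₂ := hδρ h₁
  rw [hρe] at h₂
  exact h₂

end KuratowskiHull

namespace FinHyp

open Topology unitInterval

section Selection

variable {X : Type*} [MetricSpace X]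

theorem exists_seq_mem_dist_le (S : ℕ → FinHyp X) {a : X} (ha : a ∈ (S 0).toSet) :
    ∃ x : ℕ → X, x 0 = a ∧ (∀ k, x k ∈ (S k).toSet) ∧
      ∀ k, dist (x k) (x (k + 1)) ≤ dist (S k) (S (k + 1)) := by
  have step : ∀ k, ∀ x : (S k).toSet, ∃ y : (S (k + 1)).toSet,
      dist (x : X) y ≤ dist (S k) (S (k + 1)) := fun k x => by
    obtain ⟨y, hy, hxy⟩ := ((dist_le_iff dist_nonneg).1 le_rfl).1 (x : X) x.2
    exact ⟨⟨y, hy⟩, hxy⟩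
  choose next hnext using step
  let x : ∀ k, (S k).toSet := fun k => Nat.rec ⟨a, ha⟩ next k
  exact ⟨fun k => (x k).1, rfl, fun k => (x k).2, fun k => hnext k (x k)⟩

theorem exists_pos_forall_dist_le_imp_eq (A : FinHyp X) {ε : ℝ} (hε : 0 < ε) :
    ∃ η, 0 < η ∧ η ≤ ε ∧ ∀ p ∈ A.toSet, ∀ q ∈ A.toSet, dist p q ≤ 4 * η → p = q := by
  have h : ∀ᶠ η : ℝ in 𝓝[>] 0, ∀ p ∈ A.toSet, ∀ q ∈ A.toSet, dist p q ≤ 4 * η → p = q := by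
    refine (eventually_all_finite A.finite_toSet).2 fun p _ =>
      (eventually_all_finite A.finite_toSet).2 fun q _ => ?_
    rcases eq_or_ne p q with rfl | hpq
    · simp
    filter_upwards [Ioo_mem_nhdsGT (div_pos (dist_pos.2 hpq) (four_pos (α := ℝ)))] with η hη hle
    linarith [hη.2]
  obtain ⟨η, h, h'⟩ := (h.and (Ioc_mem_nhdsGT hε)).exists
  exact ⟨η, h'.1, h'.2, h⟩

variable {S : ℝ → FinHyp X} {x : ℕ → ℕ → X}

theorem exists_eventually_dist_le (hS : Continuous S)
    (hx : ∀ n k : ℕ, x n k ∈ (S (k / n)).toSet)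
    (hxS : ∀ n k : ℕ, dist (x n k) (x n (k + 1)) ≤ dist (S (k / n)) (S ((k + 1 : ℕ) / n)))
    {t₀ ε : ℝ} (ht₀ : 0 ≤ t₀) (hε : 0 < ε) :
    ∃ δ > 0, ∀ᶠ n : ℕ in atTop, ∃ q ∈ (S t₀).toSet, ∀ t, 0 ≤ t → |t - t₀| < δ →
      dist (x n ⌊n * t⌋₊) q ≤ ε := by
  obtain ⟨η, hη, hηε, hsep⟩ := exists_pos_forall_dist_le_imp_eq (S t₀) hε
  obtain ⟨δ, hδ, hSδ⟩ := Metric.continuousAt_iff.1 (hS.continuousAt (x := t₀)) η hη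
  refine ⟨δ / 2, half_pos hδ, ?_⟩
  filter_upwards [tendsto_natCast_atTop_atTop.eventually_gt_atTop (2 / δ)] with n hn
  have hn0 : (0 : ℝ) < n := (by positivity : (0 : ℝ) < 2 / δ).trans hn
  have hfloor : ∀ t : ℝ, 0 ≤ t → |t - t₀| < δ / 2 → |(⌊n * t⌋₊ : ℝ) / n - t₀| < δ := by
    intro t ht htt
    have h₁ : (⌊n * t⌋₊ : ℝ) / n ≤ t := by
      rw [div_le_iff₀ hn0, mul_comm t]
      exact Nat.floor_le (by positivity)
    have h₂ : t < (⌊n * t⌋₊ : ℝ) / n + δ / 2 := by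
      have h₃ : (n : ℝ) * t < ⌊n * t⌋₊ + 1 := Nat.lt_floor_add_one _
      have h₄ : 1 < n * (δ / 2) := by
        rw [div_lt_iff₀ hδ] at hn
        linarith
      have h₅ : (⌊n * t⌋₊ : ℝ) / n * n = ⌊n * t⌋₊ := div_mul_cancel₀ _ hn0.ne'
      nlinarith
    rw [abs_lt] at htt ⊢
    constructor <;> linarith [htt.1, htt.2]
  have hex : ∃ k : ℕ, |(k : ℝ) / n - t₀| < δ := ⟨_, hfloor t₀ ht₀ (by simpa using half_pos hδ)⟩
  classical
  set k₀ := Nat.find hex with hk₀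
  have hclose : ∀ k : ℕ, |(k : ℝ) / n - t₀| < δ → ∃ p ∈ (S t₀).toSet, dist (x n k) p ≤ η :=
    fun k hk => ((dist_le_iff hη.le).1 (hSδ hk).le).1 _ (hx n k)
  obtain ⟨q, hq, hq₀⟩ := hclose k₀ (Nat.find_spec hex)
  refine ⟨q, hq, fun t ht htt => le_trans ?_ hηε⟩
  have key : ∀ l, k₀ ≤ l → |(l : ℝ) / n - t₀| < δ → dist (x n l) q ≤ η := by
    intro l hl
    induction l, hl using Nat.le_induction with
    | base => exact fun _ => hq₀
    | succ l hl ih =>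
      intro hl'
      have hlδ : |(l : ℝ) / n - t₀| < δ := by
        have h₁ : (k₀ : ℝ) / n ≤ l / n := by gcongr
        have h₂ : (l : ℝ) / n ≤ (l + 1 : ℕ) / n := by gcongr; exact l.le_succ
        have h₃ := Nat.find_spec hex
        rw [← hk₀] at h₃
        rw [abs_lt] at hl' h₃ ⊢
        constructor <;> linarith [hl'.2, h₃.1]
      obtain ⟨p, hp, hpx⟩ := hclose (l + 1) hl'
      rw [← hsep p hp q hq]
      · exact hpx
      have h₁ := hxS n l
      have h₂ := hSδ hlδ
      have h₃ := hSδ hl'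
      have h₄ := dist_triangle_right (S (l / n)) (S ((l + 1 : ℕ) / n)) (S t₀)
      have h₅ := ih hlδ
      have h₆ := dist_triangle4 p (x n (l + 1)) (x n l) q
      rw [dist_comm p (x n (l + 1)), dist_comm (x n (l + 1)) (x n l)] at h₆
      linarith
  exact key _ (Nat.find_min' hex (hfloor t ht htt)) (hfloor t ht htt)

/-- A path of finite sets has a continuous selection through any point of its initial set. -/
theorem exists_selection (hS : Continuous S) {a : X} (ha : a ∈ (S 0).toSet) :
    ∃ f : I → X, Continuous f ∧ f 0 = a ∧ ∀ t : I, f t ∈ (S t).toSet := by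
  have hseq : ∀ n : ℕ, ∃ x : ℕ → X, x 0 = a ∧ (∀ k : ℕ, x k ∈ (S (k / n)).toSet) ∧
      ∀ k : ℕ, dist (x k) (x (k + 1)) ≤ dist (S (k / n)) (S ((k + 1 : ℕ) / n)) := fun n =>
    exists_seq_mem_dist_le (fun k => S (k / n)) (by simpa using ha)
  choose x hx₀ hx hxS using hseq
  have hU : (hyperfilter ℕ : Filter ℕ) ≤ atTop := Nat.hyperfilter_le_atTop
  have claim : ∀ t₀ : I, ∀ ε > 0, ∃ δ > 0, ∃ q ∈ (S t₀).toSet, ∀ᶠ n : ℕ in hyperfilter ℕ,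
      ∀ t : I, dist t t₀ < δ → dist (x n ⌊n * (t : ℝ)⌋₊) q ≤ ε := by
    intro t₀ ε hε
    obtain ⟨δ, hδ, h⟩ := exists_eventually_dist_le hS hx hxS t₀.2.1 hε
    obtain ⟨q, hq, hqn⟩ :=
      (Ultrafilter.eventually_exists_mem_iff (S t₀).finite_toSet).1 (hU h)
    exact ⟨δ, hδ, q, hq, hqn.mono fun n hn t ht => hn t t.2.1 ht⟩
  have hlim : ∀ t : I, ∃ q ∈ (S t).toSet,
      Tendsto (fun n : ℕ => x n ⌊n * (t : ℝ)⌋₊) (hyperfilter ℕ) (𝓝 q) := by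
    intro t
    by_contra! hno
    have hfin : ∀ᶠ η : ℝ in 𝓝[>] 0, ∀ q ∈ (S t).toSet,
        ¬ ∀ᶠ n : ℕ in hyperfilter ℕ, dist (x n ⌊n * (t : ℝ)⌋₊) q ≤ η := by
      refine (eventually_all_finite (S t).finite_toSet).2 fun q hq => ?_
      have h := hno q hq
      rw [Metric.tendsto_nhds] at h
      push Not at h
      obtain ⟨ε, hε, h⟩ := h
      filter_upwards [Ioo_mem_nhdsGT hε] with η hη hn
      obtain ⟨n, hn₁, hn₂⟩ := (h.and hn).exists
      exact (hn₁.trans hn₂).not_gt hη.2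
    obtain ⟨η, hη, hη₀⟩ := (hfin.and self_mem_nhdsWithin).exists
    obtain ⟨δ, hδ, q, hq, hqn⟩ := claim t η hη₀
    exact hη q hq (hqn.mono fun n hn => hn t (by simpa using hδ))
  choose f hfS hf using hlim
  refine ⟨f, ?_, ?_, hfS⟩
  · rw [Metric.continuous_iff]
    intro t₀ ε hε
    obtain ⟨δ, hδ, q, -, hqn⟩ := claim t₀ (ε / 3) (by positivity)
    have hle : ∀ t : I, dist t t₀ < δ → dist (f t) q ≤ ε / 3 := fun t ht =>
      le_of_tendsto ((hf t).dist tendsto_const_nhds) (hqn.mono fun n hn => hn t ht)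
    refine ⟨δ, hδ, fun t ht => ?_⟩
    have h₁ := hle t ht
    have h₂ := hle t₀ (by simpa using hδ)
    linarith [dist_triangle_right (f t) (f t₀) q]
  · refine tendsto_nhds_unique (hf 0) ?_
    simp [hx₀]

theorem exists_path_of_path_single {a b : X} (p : Path (single a) (single b)) :
    ∃ γ : Path a b, ∀ t, γ t ∈ (p t).toSet := by
  obtain ⟨f, hf, hf₀, hfp⟩ := exists_selection (S := p.extend) p.continuous_extend (a := a)
    (by simp)
  have hfp' : ∀ t : I, f t ∈ (p t).toSet := fun t => by simpa using hfp t
  exact ⟨⟨⟨f, hf⟩, hf₀, by simpa using hfp' 1⟩, hfp'⟩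

end Selection

section Converse

variable {X : Type u} [MetricSpace X]

theorem pathConnectedSpace_of_isAR (h : IsAR (FinHyp X)) : PathConnectedSpace X where
  nonempty := h.nonempty.elim fun A => ⟨A.nonempty_toSet.some⟩
  joined a b := (h.exists_path.1 (single a) (single b)).elim fun p =>
    ⟨(exists_path_of_path_single p).choose⟩

theorem locallyPathConnectedSpace_of_isAR (h : IsAR (FinHyp X)) :
    LocallyPathConnectedSpace X := by
  rw [locallyPathConnectedSpace_iff_pathComponentIn_mem_nhds]
  intro x u hu hxu
  obtain ⟨ε, hε, hεu⟩ := Metric.isOpen_iff.1 hu x hxu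
  obtain ⟨δ, hδ, hp⟩ := h.exists_path.2 (single x) ε hε
  filter_upwards [Metric.ball_mem_nhds x hδ] with y hy
  have hyx : dist (single y) (single x) ≤ dist y x :=
    (dist_single_le_iff dist_nonneg).2 (by simp)
  obtain ⟨p, hpε⟩ := hp (single y) (hyx.trans_lt hy)
  obtain ⟨γ, hγ⟩ := exists_path_of_path_single p
  exact ⟨γ, fun t => hεu
    (((dist_single_le_iff dist_nonneg).1 le_rfl _ (hγ t)).trans_lt (hpε t))⟩

end Converse

end FinHyp

/-- (Curtis–Nhu) The hyperspace `Fin(X)` of nonempty finite subsets of a metrizable space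
`X` is an absolute retract if and only if `X` is connected and locally path-connected. -/
theorem finHyp_isAR_iff (X : Type u) [MetricSpace X] :
    IsAR (FinHyp X) ↔ ConnectedSpace X ∧ LocPathConnectedSpace X := by
  refine ⟨fun h => ?_, fun ⟨_, hloc⟩ => ?_⟩
  · have := FinHyp.pathConnectedSpace_of_isAR h
    exact ⟨inferInstance, FinHyp.locallyPathConnectedSpace_of_isAR h⟩
  · have : LocallyPathConnectedSpace X := hloc
    exact FinHyp.isAR
end

section
/- Let (X,d) be a metric space and suppose {A_n}_{n∈ℕ} is a sequence in Fin(X) converging (in the Hausdorff metric) to A ∈ Fin(X). Then for any choice of nonempty subsets B_n ⊆ A_n, the sequence {B_n}_{n∈ℕ} has a subsequence converging in the Hausdorff metric to some nonempty finite set B with B ⊆ A. -/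
open Set Metric Filter TopologicalSpace

theorem FinHyp.toSet_injective_s4 (X : Type*) [MetricSpace X] :
    Function.Injective (FinHyp.toSet : FinHyp X → Set X) := fun _ _ h =>
  Subtype.ext (NonemptyCompacts.ext h)

/-- A member of the hyperspace has only finitely many subsets in the hyperspace. -/
theorem FinHyp.finite_setOf_toSet_subset {X : Type*} [MetricSpace X] (a : FinHyp X) :
    {C : FinHyp X | C.toSet ⊆ a.toSet}.Finite :=
  Set.Finite.preimage (FinHyp.toSet_injective_s4 X).injOn a.2.finite_subsets

/-- If `A` is `ε`-close to `a`, then every subset of `A` is `ε`-close to some subset of `a`. -/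
theorem FinHyp.exists_subset_dist_le {X : Type*} [MetricSpace X] {A a B : FinHyp X} {ε : ℝ}
    (hBA : B.toSet ⊆ A.toSet) (h : dist A a < ε) :
    ∃ C : FinHyp X, C.toSet ⊆ a.toSet ∧ dist B C ≤ ε := by
  have hε : 0 ≤ ε := dist_nonneg.trans h.le
  have hfin : hausdorffEDist A.toSet a.toSet ≠ ⊤ :=
    hausdorffEDist_ne_top_of_nonempty_of_bounded A.1.nonempty a.1.nonempty
      A.2.isBounded a.2.isBounded
  have hclose : ∀ y ∈ B.toSet, ∃ x ∈ a.toSet, dist y x < ε := fun y hy =>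
    exists_dist_lt_of_hausdorffDist_lt (hBA hy) h hfin
  let S : Set X := {x ∈ a.toSet | ∃ y ∈ B.toSet, dist y x < ε}
  have hS : S.Finite := a.2.subset (sep_subset _ _)
  have hne : S.Nonempty := by
    obtain ⟨y, hy⟩ := B.1.nonempty
    obtain ⟨x, hx, hyx⟩ := hclose y hy
    exact ⟨x, hx, y, hy, hyx⟩
  refine ⟨⟨⟨⟨S, hS.isCompact⟩, hne⟩, hS⟩, sep_subset _ _, ?_⟩
  refine hausdorffDist_le_of_mem_dist hε (fun y hy => ?_) ?_
  · obtain ⟨x, hx, hyx⟩ := hclose y hy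
    exact ⟨x, ⟨hx, y, hy, hyx⟩, hyx.le⟩
  · rintro x ⟨-, y, hy, hyx⟩
    exact ⟨y, hy, by rw [dist_comm]; exact hyx.le⟩

/-- If a sequence `A n` in `Fin(X)` converges in the Hausdorff metric to `a ∈ Fin(X)`,
then for any choice of nonempty (finite) subsets `B n ⊆ A n`, the sequence `B n` has a
subsequence converging in the Hausdorff metric to some `b ∈ Fin(X)` with `b ⊆ a`. -/
theorem finHyp_subsets_exists_convergent_subseq (X : Type*) [MetricSpace X]
    (A : ℕ → FinHyp X) (a : FinHyp X) (hA : Tendsto A atTop (nhds a))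
    (B : ℕ → FinHyp X) (hB : ∀ n, (B n).toSet ⊆ (A n).toSet) :
    ∃ φ : ℕ → ℕ, StrictMono φ ∧
      ∃ b : FinHyp X, b.toSet ⊆ a.toSet ∧ Tendsto (B ∘ φ) atTop (nhds b) := by
  choose C hCa hBC using fun n =>
    FinHyp.exists_subset_dist_le (hB n)
      (lt_add_of_pos_right (dist (A n) a) (Nat.one_div_pos_of_nat (α := ℝ) (n := n)))
  obtain ⟨b, hb, φ, hφ, hCb⟩ := a.finite_setOf_toSet_subset.isCompact.tendsto_subseq hCa
  refine ⟨φ, hφ, b, hb, ?_⟩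
  have hε : Tendsto (fun n : ℕ => dist (A n) a + 1 / ((n : ℝ) + 1)) atTop (nhds 0) := by
    simpa using (tendsto_iff_dist_tendsto_zero.1 hA).add tendsto_one_div_add_atTop_nhds_zero_nat
  have hdist : Tendsto (fun n => dist (C n) (B n)) atTop (nhds 0) :=
    squeeze_zero (fun _ => dist_nonneg) (fun n => (dist_comm _ _).trans_le (hBC n)) hε
  exact hCb.congr_dist (hdist.comp hφ.tendsto_atTop)
end

section
/- Let Y be a metrizable ANR and let A be a closed subset of Y that is completely metrizable (topologically complete). If A is a countable union of strong Z-sets in Y, then A is itself a strong Z-set in Y. -/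
open Set TopologicalSpace

universe u

/-- A metrizable space `Y` is an absolute neighborhood retract (ANR) if whenever `Y` is
embedded as a closed subspace of a metrizable space `Z`, the image of `Y` is a retract of
some open neighborhood of it in `Z`. -/
def IsANR (Y : Type u) [TopologicalSpace Y] : Prop :=
  ∀ (Z : Type u) [TopologicalSpace Z] [TopologicalSpace.MetrizableSpace Z] (e : Y → Z),
    Topology.IsClosedEmbedding e →
      ∃ U : Set Z, IsOpen U ∧ Set.range e ⊆ U ∧
        ∃ r : Z → Z, ContinuousOn r U ∧ r '' U ⊆ Set.range e ∧ ∀ z ∈ Set.range e, r z = z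

open Metric Filter Topology

section ControlFunction

variable {Y : Type*} [MetricSpace Y]

/-- A family of sets has a `1`-Lipschitz Lebesgue function: it is positive on the interiors of the
members, and the ball of radius `δ y` about `y` lies in a member wherever `δ y` is positive. -/
theorem exists_lipschitz_lebesgue_function (𝒪 : Set (Set Y)) :
    ∃ δ : Y → ℝ, LipschitzWith 1 δ ∧ (∀ y, 0 ≤ δ y) ∧ (∀ y, δ y ≤ 1) ∧
      (∀ y, 0 < δ y → ∃ O ∈ 𝒪, ball y (δ y) ⊆ O) ∧
      ∀ O ∈ 𝒪, IsOpen O → ∀ y ∈ O, 0 < δ y := by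
  set T : Y → Set ℝ := fun y => {r | r ≤ 1 ∧ (r ≤ 0 ∨ ∃ O ∈ 𝒪, ball y r ⊆ O)}
  have hzero : ∀ y, (0 : ℝ) ∈ T y := fun y => ⟨zero_le_one, Or.inl le_rfl⟩
  have hbdd : ∀ y, BddAbove (T y) := fun y => ⟨1, fun r hr => hr.1⟩
  have hnonneg : ∀ y, 0 ≤ sSup (T y) := fun y => le_csSup (hbdd y) (hzero y)
  have hle : ∀ y, sSup (T y) ≤ 1 := fun y => csSup_le ⟨0, hzero y⟩ fun r hr => hr.1
  have hlip : ∀ x y, sSup (T x) ≤ sSup (T y) + dist x y := by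
    intro x y
    refine csSup_le ⟨0, hzero x⟩ fun r hr => ?_
    rw [← sub_le_iff_le_add]
    refine le_csSup (hbdd y) ⟨by linarith [hr.1, dist_nonneg (x := x) (y := y)], ?_⟩
    rcases hr.2 with h | ⟨O, hO, hrO⟩
    · exact Or.inl (by linarith [dist_nonneg (x := x) (y := y)])
    · refine Or.inr ⟨O, hO, (ball_subset_ball' ?_).trans hrO⟩
      rw [dist_comm y x]
      linarith
  refine ⟨fun y => sSup (T y) / 2, LipschitzWith.of_le_add fun x y => ?_, fun y => ?_, fun y => ?_,
    fun y hy => ?_, fun O hO hOo y hy => ?_⟩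
  · have := hlip x y
    have := dist_nonneg (x := x) (y := y)
    linarith
  · have := hnonneg y
    positivity
  · have := hle y
    have := hnonneg y
    dsimp only
    linarith
  · obtain ⟨r, hr, hlt⟩ := exists_lt_of_lt_csSup ⟨0, hzero y⟩ (show sSup (T y) / 2 < sSup (T y) by
      linarith)
    rcases hr.2 with h | ⟨O, hO, hrO⟩
    · linarith
    · exact ⟨O, hO, (ball_subset_ball hlt.le).trans hrO⟩
  · obtain ⟨r, hr, hrO⟩ := Metric.isOpen_iff.1 hOo y hy
    have : min r 1 ≤ sSup (T y) := le_csSup (hbdd y)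
      ⟨min_le_right _ _, Or.inr ⟨O, hO, (ball_subset_ball (min_le_left _ _)).trans hrO⟩⟩
    have : 0 < min r 1 := lt_min hr one_pos
    linarith

end ControlFunction

section ConvexEmbedding

variable {Y : Type*} [MetricSpace Y]

/-- The Kuratowski map of a pointed metric space into its bounded continuous functions. -/
noncomputable def kuratowskiMap (x₀ y : Y) : BoundedContinuousFunction Y ℝ :=
  BoundedContinuousFunction.ofNormedAddCommGroup (fun x => dist x y - dist x x₀) (by fun_prop)
    (dist y x₀) fun x => by
      rw [Real.norm_eq_abs, dist_comm x y, dist_comm x x₀]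
      exact abs_dist_sub_le y x₀ x

theorem kuratowskiMap_apply (x₀ y x : Y) : kuratowskiMap x₀ y x = dist x y - dist x x₀ := rfl

theorem isometry_kuratowskiMap (x₀ : Y) : Isometry (kuratowskiMap x₀) := by
  refine Isometry.of_dist_eq fun y z => le_antisymm ?_ ?_
  · refine (BoundedContinuousFunction.dist_le dist_nonneg).2 fun x => ?_
    rw [Real.dist_eq, kuratowskiMap_apply, kuratowskiMap_apply, sub_sub_sub_cancel_right,
      dist_comm x y, dist_comm x z]
    exact abs_dist_sub_le y z x
  · have := BoundedContinuousFunction.dist_coe_le_dist (f := kuratowskiMap x₀ y)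
      (g := kuratowskiMap x₀ z) z
    rw [Real.dist_eq, kuratowskiMap_apply, kuratowskiMap_apply, sub_sub_sub_cancel_right,
      dist_self, sub_zero, abs_of_nonneg dist_nonneg, dist_comm z y] at this
    exact this

theorem exists_mul_dist_le_of_mem_convexHull_s6 (x₀ : Y) {h : BoundedContinuousFunction Y ℝ}
    (hh : h ∈ convexHull ℝ (range (kuratowskiMap x₀))) :
    ∃ (y : Y) (t : ℝ), 0 < t ∧ ∀ z, t * dist z y ≤ h z + dist z x₀ := by
  have hconv : Convex ℝ {h : BoundedContinuousFunction Y ℝ |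
      ∃ (y : Y) (t : ℝ), 0 < t ∧ ∀ z, t * dist z y ≤ h z + dist z x₀} := by
    rintro h ⟨y, t, ht, hy⟩ h' ⟨y', t', ht', hy'⟩ a b ha hb hab
    have key : ∀ z, (a • h + b • h') z + dist z x₀ =
        a * (h z + dist z x₀) + b * (h' z + dist z x₀) := by
      intro z
      simp only [BoundedContinuousFunction.coe_add, BoundedContinuousFunction.coe_smul,
        Pi.add_apply, smul_eq_mul]
      linear_combination (-dist z x₀) * hab
    have hpos' : ∀ z, 0 ≤ h' z + dist z x₀ := fun z => le_trans (by positivity) (hy' z)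
    rcases ha.eq_or_lt with rfl | ha
    · have hb1 : b = 1 := by linarith
      refine ⟨y', t', ht', fun z => ?_⟩
      rw [key, hb1]
      linarith [hy' z]
    · refine ⟨y, a * t, by positivity, fun z => ?_⟩
      rw [key, mul_assoc]
      exact (mul_le_mul_of_nonneg_left (hy z) ha.le).trans
        (le_add_of_nonneg_right (mul_nonneg hb (hpos' z)))
  refine convexHull_min ?_ hconv hh
  rintro _ ⟨y, rfl⟩
  refine ⟨y, 1, one_pos, fun z => ?_⟩
  rw [kuratowskiMap_apply]
  linarith

/-- The Kuratowski map, as a map into the convex hull of its range. -/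
noncomputable def wojdyslawskiMap (x₀ y : Y) : convexHull ℝ (range (kuratowskiMap x₀)) :=
  ⟨kuratowskiMap x₀ y, subset_convexHull ℝ _ (mem_range_self y)⟩

/-- The Kuratowski–Wojdysławski theorem. -/
theorem isClosedEmbedding_wojdyslawskiMap (x₀ : Y) :
    IsClosedEmbedding (wojdyslawskiMap x₀) := by
  have hiso : Isometry (wojdyslawskiMap x₀) := Isometry.of_dist_eq fun y z =>
    (isometry_kuratowskiMap x₀).dist_eq y z
  refine ⟨hiso.isEmbedding, isClosed_of_closure_subset fun h hh => ?_⟩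
  obtain ⟨y, t, ht, hy⟩ := exists_mul_dist_le_of_mem_convexHull_s6 x₀ h.2
  refine ⟨y, ?_⟩
  refine eq_of_forall_dist_le fun ε hε => ?_
  obtain ⟨_, ⟨z, rfl⟩, hz⟩ := Metric.mem_closure_iff.1 hh (ε / (1 + 1 / t)) (by positivity)
  have h1 := BoundedContinuousFunction.dist_coe_le_dist (f := h.1) (g := kuratowskiMap x₀ z) z
  rw [Real.dist_eq, kuratowskiMap_apply, dist_self, zero_sub, sub_neg_eq_add] at h1
  have h2 : t * dist z y ≤ dist h (wojdyslawskiMap x₀ z) :=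
    (hy z).trans ((le_abs_self _).trans h1)
  have h3 : dist z y ≤ dist h (wojdyslawskiMap x₀ z) * (1 / t) := by
    rw [mul_one_div, le_div_iff₀ ht]
    linarith
  calc dist (wojdyslawskiMap x₀ y) h
      ≤ dist (wojdyslawskiMap x₀ z) (wojdyslawskiMap x₀ y) + dist h (wojdyslawskiMap x₀ z) := by
        rw [dist_comm (wojdyslawskiMap x₀ z), dist_comm h]
        exact dist_triangle _ _ _
    _ ≤ dist h (wojdyslawskiMap x₀ z) * (1 + 1 / t) := by
        rw [hiso.dist_eq]
        linarith
    _ ≤ ε := by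
        rw [lt_div_iff₀ (by positivity)] at hz
        exact hz.le

end ConvexEmbedding

section ANR

variable {Y : Type u} [MetricSpace Y]

/-- In an ANR, a map sufficiently close to the identity can be joined to the identity by a small
homotopy; here the homotopy is evaluated at a variable time `l`. -/
theorem IsANR.exists_cover_interpolation (hY : IsANR Y) {s : Y → ℝ} (hs : Continuous s)
    (hpos : ∀ y, 0 < s y) :
    ∃ 𝒱 : Set (Set Y), (∀ V ∈ 𝒱, IsOpen V) ∧ ⋃₀ 𝒱 = univ ∧
      ∀ f : Y → Y, Continuous f → (∀ y, ∃ V ∈ 𝒱, y ∈ V ∧ f y ∈ V) →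
      ∀ l : Y → ℝ, Continuous l → (∀ y, l y ∈ Icc (0 : ℝ) 1) →
        ∃ g : Y → Y, Continuous g ∧ (∀ y, dist (g y) y ≤ s y) ∧
          (∀ y, l y = 0 → g y = y) ∧ ∀ y, l y = 1 → g y = f y := by
  rcases isEmpty_or_nonempty Y with hE | ⟨⟨x₀⟩⟩
  · exact ⟨∅, by simp, eq_univ_of_forall fun y => isEmptyElim y,
      fun f hf _ l _ _ => ⟨f, hf, fun y => isEmptyElim y, fun y => isEmptyElim y, fun _ _ => rfl⟩⟩
  set e := wojdyslawskiMap x₀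
  have hemb : IsClosedEmbedding e := isClosedEmbedding_wojdyslawskiMap x₀
  obtain ⟨U, hU, hrU, r, hr, hrr, hre⟩ := hY _ e hemb
  have hlift : ∀ p, ∃ y, p ∈ U → e y = r p := fun p => by
    by_cases hp : p ∈ U
    · obtain ⟨y, hy⟩ := hrr (mem_image_of_mem r hp)
      exact ⟨y, fun _ => hy⟩
    · exact ⟨x₀, fun h => absurd h hp⟩
  choose R hR using hlift
  have hRe : ∀ y, R (e y) = y := fun y => hemb.injective
    ((hR _ (hrU (mem_range_self y))).trans (hre _ (mem_range_self y)))
  have hRc : ContinuousOn R U := by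
    rw [hemb.isInducing.continuousOn_iff]
    exact hr.congr fun p hp => hR p hp
  have hball : ∀ y₀, ∃ ρ > 0, ball (e y₀) ρ ⊆ U ∩ {p | dist (R p) y₀ < s y₀ / 3} := by
    intro y₀
    rw [← Metric.mem_nhds_iff]
    have hUn : U ∈ 𝓝 (e y₀) := hU.mem_nhds (hrU (mem_range_self y₀))
    refine inter_mem hUn ?_
    have hc : ContinuousAt R (e y₀) := hRc.continuousAt hUn
    have := hc (ball_mem_nhds (R (e y₀)) (show 0 < s y₀ / 3 by linarith [hpos y₀]))
    rw [hRe] at this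
    exact this
  choose ρ hρ hρU using hball
  refine ⟨range fun y₀ => {y | dist (e y) (e y₀) < ρ y₀} ∩ {y | dist y y₀ < s y₀ / 3} ∩
    {y | 2 * s y₀ / 3 < s y}, ?_, ?_, ?_⟩
  · rintro _ ⟨y₀, rfl⟩
    refine IsOpen.inter (IsOpen.inter ?_ ?_) ?_
    · exact isOpen_lt (hemb.continuous.dist continuous_const) continuous_const
    · exact isOpen_lt (by fun_prop) continuous_const
    · exact isOpen_lt continuous_const hs
  · refine eq_univ_of_forall fun y => ⟨_, ⟨y, rfl⟩, ⟨?_, ?_⟩, ?_⟩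
    · simpa using hρ y
    · simpa using hpos y
    · have := hpos y
      change 2 * s y / 3 < s y
      linarith
  · intro f hf hfV l hl hl01
    have hmem : ∀ y, (1 - l y) • (e y : BoundedContinuousFunction Y ℝ) +
        l y • (e (f y) : BoundedContinuousFunction Y ℝ) ∈
          convexHull ℝ (range (kuratowskiMap x₀)) := fun y =>
      (convex_convexHull ℝ _) (e y).2 (e (f y)).2 (by linarith [(hl01 y).2]) (hl01 y).1 (by ring)
    set P : Y → convexHull ℝ (range (kuratowskiMap x₀)) := fun y => ⟨_, hmem y⟩ with hP
    have hPc : Continuous P := by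
      refine Continuous.subtype_mk ?_ _
      have h1 : Continuous fun y => (e y : BoundedContinuousFunction Y ℝ) :=
        continuous_subtype_val.comp hemb.continuous
      exact ((continuous_const.sub hl).smul h1).add (hl.smul (h1.comp hf))
    have hPclose : ∀ y, P y ∈ U ∧ dist (R (P y)) y ≤ s y := by
      intro y
      obtain ⟨_, ⟨y₀, rfl⟩, ⟨⟨hy1, hy2⟩, hy3⟩, ⟨hf1, -⟩, -⟩ := hfV y
      have hPb : P y ∈ ball (e y₀) (ρ y₀) := by
        have := (convex_ball (e y₀ : BoundedContinuousFunction Y ℝ) (ρ y₀))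
          (x := (e y : BoundedContinuousFunction Y ℝ)) hy1 (y := (e (f y))) hf1
          (a := 1 - l y) (b := l y) (by linarith [(hl01 y).2]) (hl01 y).1 (by ring)
        exact this
      obtain ⟨h1, h2⟩ := hρU y₀ hPb
      refine ⟨h1, ?_⟩
      have h4 := dist_triangle_right (R (P y)) y y₀
      simp only [mem_ofPred_eq] at h2 hy2 hy3
      linarith
    refine ⟨fun y => R (P y), hRc.comp_continuous hPc fun y => (hPclose y).1,
      fun y => (hPclose y).2, fun y hy => ?_, fun y hy => ?_⟩
    · have : P y = e y := Subtype.ext (by simp [hP, hy])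
      simp only [this, hRe]
    · have : P y = e (f y) := Subtype.ext (by simp [hP, hy])
      simp only [this, hRe]

/-- In an ANR, the maps witnessing that `Z` is a strong `Z`-set can be controlled by a function
that is only positive on `Z`. -/
theorem IsStrongZSet.exists_dist_le (hY : IsANR Y) {Z : Set Y} (hZ : IsStrongZSet Z)
    (hne : Z.Nonempty) {θ : Y → ℝ} (hθ : Continuous θ) (hnonneg : ∀ y, 0 ≤ θ y)
    (hpos : ∀ z ∈ Z, 0 < θ z) :
    ∃ g : Y → Y, Continuous g ∧ (∀ y, dist (g y) y ≤ θ y) ∧ closure (range g) ∩ Z = ∅ := by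
  obtain ⟨hZc, hZs⟩ := hZ
  have hspos : ∀ y, 0 < θ y + infDist y Z := by
    intro y
    by_cases hy : y ∈ Z
    · linarith [hpos y hy, infDist_nonneg (s := Z) (x := y)]
    · linarith [hnonneg y, (hZc.notMem_iff_infDist_pos hne).1 hy]
  have hsc : Continuous fun y => θ y + infDist y Z := hθ.add (continuous_infDist_pt Z)
  set μ : Y → ℝ := fun y => θ y / (θ y + infDist y Z) with hμ
  have hμc : Continuous μ := hθ.div hsc fun y => (hspos y).ne'
  obtain ⟨𝒱, h𝒱o, h𝒱, H⟩ := hY.exists_cover_interpolation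
    (s := fun y => (θ y + infDist y Z) / 6) (by fun_prop) fun y => by
      have := hspos y
      positivity
  obtain ⟨f, hf, hfV, hfZ⟩ := hZs 𝒱 h𝒱o h𝒱
  obtain ⟨g, hg, hgs, hg0, hg1⟩ := H f hf hfV (fun y => max 0 (min 1 (3 * μ y - 1)))
    (by fun_prop) fun y => ⟨le_max_left _ _, max_le zero_le_one (min_le_left _ _)⟩
  refine ⟨g, hg, fun y => ?_, ?_⟩
  · rcases le_total (μ y) (1 / 3) with h | h
    · rw [hg0 y, dist_self]
      · exact hnonneg y
      · exact max_eq_left ((min_le_right _ _).trans (by linarith))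
    · rw [hμ, le_div_iff₀ (hspos y)] at h
      linarith [hgs y, hnonneg y]
  · rw [← disjoint_iff_inter_eq_empty]
    have hsub : range g ⊆ range f ∪ g '' {y | μ y ≤ 2 / 3} := by
      rintro _ ⟨y, rfl⟩
      rcases le_total (μ y) (2 / 3) with h | h
      · exact Or.inr ⟨y, h, rfl⟩
      · refine Or.inl ⟨y, (hg1 y ?_).symm⟩
        rw [min_eq_left (by linarith)]
        exact max_eq_right zero_le_one
    refine Disjoint.mono_left (closure_mono hsub) ?_
    rw [closure_union, disjoint_union_left]
    refine ⟨disjoint_iff_inter_eq_empty.2 hfZ, Set.disjoint_left.2 fun z hz hzZ => ?_⟩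
    have hcl : z ∈ closure {y | μ y ≤ 2 / 3} := by
      refine Metric.mem_closure_iff.2 fun ε hε => ?_
      obtain ⟨_, ⟨y, hy, rfl⟩, hyz⟩ := Metric.mem_closure_iff.1 hz (ε / 2) (by positivity)
      refine ⟨y, hy, ?_⟩
      have hy' : μ y ≤ 2 / 3 := hy
      rw [hμ, div_le_iff₀ (hspos y)] at hy'
      have h1 := hgs y
      have h2 := infDist_le_dist_of_mem (x := y) hzZ
      have h3 := dist_triangle z (g y) y
      rw [dist_comm y z] at h2
      linarith
    rw [IsClosed.closure_eq (isClosed_le hμc continuous_const)] at hcl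
    have hμz : μ z = 1 := by
      simp only [hμ, infDist_zero_of_mem hzZ, add_zero]
      exact div_self (hpos z hzZ).ne'
    simp only [mem_ofPred_eq, hμz] at hcl
    norm_num at hcl

/-- A controlled push off a strong `Z`-set, together with the amount by which its values may be
perturbed while staying off the strong `Z`-set. -/
theorem IsStrongZSet.exists_dist_le_stable (hY : IsANR Y) {Z : Set Y} (hZ : IsStrongZSet Z)
    {θ : Y → ℝ} (hθ : Continuous θ) (hnonneg : ∀ y, 0 ≤ θ y) (hpos : ∀ z ∈ Z, 0 < θ z) :
    ∃ (g : Y → Y) (γ : Y → ℝ), Continuous g ∧ (∀ y, dist (g y) y ≤ θ y) ∧ LipschitzWith 1 γ ∧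
      (∀ y, 0 < γ y) ∧ closure {w | ∃ y, dist (g y) w ≤ γ (g y) / 2} ∩ Z = ∅ := by
  rcases Z.eq_empty_or_nonempty with rfl | hne
  · exact ⟨id, fun _ => 1, continuous_id, fun y => by simpa using hnonneg y,
      LipschitzWith.const' 1, fun _ => one_pos, inter_empty _⟩
  obtain ⟨g, hg, hgθ, hgZ⟩ := hZ.exists_dist_le hY hne hθ hnonneg hpos
  refine ⟨g, fun y => (infDist y Z + infDist y (range g)) / 2, hg, hgθ,
    LipschitzWith.of_le_add fun x y => ?_, fun y => ?_, ?_⟩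
  · have h1 := infDist_le_infDist_add_dist (s := Z) (x := x) (y := y)
    have h2 := infDist_le_infDist_add_dist (s := range g) (x := x) (y := y)
    linarith
  · have hran : (range g).Nonempty := ⟨g y, mem_range_self y⟩
    have h1 := infDist_nonneg (s := Z) (x := y)
    have h2 := infDist_nonneg (s := range g) (x := y)
    by_cases hy : y ∈ Z
    · have hy' : y ∉ closure (range g) := fun h => by
        have : y ∈ closure (range g) ∩ Z := ⟨h, hy⟩
        rw [hgZ] at this
        exact this
      have h3 := (infDist_pos_iff_notMem_closure (x := y) hran).1 hy'
      linarith
    · have h3 := (hZ.1.notMem_iff_infDist_pos hne).1 hy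
      linarith
  · refine eq_empty_of_forall_notMem fun z ⟨hz, hzZ⟩ => ?_
    have : z ∈ closure (range g) ∩ Z := by
      refine ⟨Metric.mem_closure_iff.2 fun ε hε => ?_, hzZ⟩
      obtain ⟨w, ⟨y, hy⟩, hw⟩ := Metric.mem_closure_iff.1 hz (ε / 2) (by positivity)
      refine ⟨g y, mem_range_self y, ?_⟩
      simp only [infDist_zero_of_mem (mem_range_self (f := g) y)] at hy
      have h1 := infDist_le_dist_of_mem (x := g y) hzZ
      have h2 := dist_triangle_right z (g y) w
      rw [dist_comm (g y) z] at h1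
      linarith
    rw [hgZ] at this
    exact this

end ANR

section CompleteSubset

variable {Y : Type*} [MetricSpace Y]

/-- A completely metrizable subset has a decreasing sequence of open covers such that a sequence
which eventually lies uniformly deep inside a member of each of them converges. -/
theorem exists_covers_tendsto_of_complete {A : Set Y}
    (hcomplete : ∃ m : MetricSpace ↥A,
      m.toUniformSpace.toTopologicalSpace = (inferInstance : TopologicalSpace ↥A) ∧
        @CompleteSpace ↥A m.toUniformSpace) :
    ∃ 𝒪 : ℕ → Set (Set Y), (∀ n, ∀ O ∈ 𝒪 n, IsOpen O) ∧ (∀ n, A ⊆ ⋃₀ 𝒪 n) ∧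
      ∀ y : ℕ → Y, (∀ n, ∃ O ∈ 𝒪 n, ∃ r > 0, ∀ᶠ k in atTop, ball (y k) r ⊆ O) →
        ∃ a, Tendsto y atTop (𝓝 a) := by
  obtain ⟨m, hm, hmc⟩ := hcomplete
  refine ⟨fun n => {O | IsOpen O ∧ O ⊆ thickening (1 / (n + 1 : ℝ)) A ∧
    ∀ a b : A, a.1 ∈ O → b.1 ∈ O → m.dist a b < 1 / (n + 1 : ℝ)}, fun n O hO => hO.1,
    fun n a ha => ?_, fun y hy => ?_⟩
  · have hn : (0 : ℝ) < 1 / (n + 1 : ℝ) := by positivity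
    have hop : @IsOpen A instTopologicalSpaceSubtype
        {b : A | m.dist b ⟨a, ha⟩ < 1 / (n + 1 : ℝ) / 2} := by
      rw [show (instTopologicalSpaceSubtype : TopologicalSpace A) = _ from hm.symm]
      exact @Metric.isOpen_ball A m.toPseudoMetricSpace ⟨a, ha⟩ (1 / (n + 1 : ℝ) / 2)
    obtain ⟨O, hO, hOA⟩ := isOpen_induced_iff.1 hop
    have hOmem : ∀ b : A, b.1 ∈ O ↔ m.dist b ⟨a, ha⟩ < 1 / (n + 1 : ℝ) / 2 := fun b =>
      (Set.ext_iff.1 hOA b)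
    refine ⟨O ∩ thickening (1 / (n + 1 : ℝ)) A, ⟨hO.inter isOpen_thickening, inter_subset_right,
      fun b c hb hc => ?_⟩, (hOmem ⟨a, ha⟩).2 ?_, ?_⟩
    · have h1 := (hOmem b).1 hb.1
      have h2 := (hOmem c).1 hc.1
      have h3 := @dist_triangle_right A m.toPseudoMetricSpace b c ⟨a, ha⟩
      exact h3.trans_lt (by linarith)
    · have : m.dist (⟨a, ha⟩ : A) ⟨a, ha⟩ = 0 := m.dist_self _
      rw [this]
      positivity
    · exact self_subset_thickening hn A ha
  · choose O hO r hr hyO using hy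
    have hthick : ∀ n : ℕ, ∀ᶠ k in atTop, y k ∈ thickening (1 / (n + 1 : ℝ)) A := fun n =>
      (hyO n).mono fun k hk => (hO n).2.1 (hk (mem_ball_self (hr n)))
    have hne : A.Nonempty := by
      obtain ⟨k, hk⟩ := (hthick 0).exists
      obtain ⟨a, ha, -⟩ := mem_thickening_iff.1 hk
      exact ⟨a, ha⟩
    have hnear : ∀ k : ℕ, ∃ a : A, dist (y k) a < infDist (y k) A + 1 / (k + 1 : ℝ) := fun k => by
      obtain ⟨a, ha, h⟩ := (infDist_lt_iff hne).1 (show infDist (y k) A < _ from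
        lt_add_of_pos_right _ (show 0 < 1 / (k + 1 : ℝ) by positivity))
      exact ⟨⟨a, ha⟩, h⟩
    choose a ha using hnear
    have hinf : Tendsto (fun k => infDist (y k) A) atTop (𝓝 0) := by
      refine Metric.tendsto_nhds.2 fun ε hε => ?_
      obtain ⟨n, hn⟩ := exists_nat_one_div_lt hε
      refine (hthick n).mono fun k hk => ?_
      obtain ⟨b, hb, hkb⟩ := mem_thickening_iff.1 hk
      rw [Real.dist_eq, sub_zero, abs_of_nonneg infDist_nonneg]
      linarith [infDist_le_dist_of_mem (x := y k) hb]
    have hdist : Tendsto (fun k => dist (y k) (a k)) atTop (𝓝 0) := by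
      refine squeeze_zero (fun _ => dist_nonneg) (fun k => (ha k).le) ?_
      simpa using hinf.add tendsto_one_div_add_atTop_nhds_zero_nat
    have haO : ∀ n, ∀ᶠ k in atTop, (a k).1 ∈ O n := fun n => by
      filter_upwards [hyO n, hdist.eventually_lt_const (hr n)] with k hk hka
      refine hk ?_
      rwa [mem_ball, dist_comm]
    have hcauchy : @CauchySeq A ℕ m.toUniformSpace _ a := by
      refine (@Metric.cauchySeq_iff A ℕ m.toPseudoMetricSpace _ _ a).2 fun ε hε => ?_
      obtain ⟨n, hn⟩ := exists_nat_one_div_lt hε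
      obtain ⟨N, hN⟩ := eventually_atTop.1 (haO n)
      exact ⟨N, fun i hi j hj => ((hO n).2.2 _ _ (hN i hi) (hN j hj)).trans hn⟩
    obtain ⟨b, hb⟩ := @cauchySeq_tendsto_of_complete A ℕ m.toUniformSpace _ hmc a hcauchy
    rw [hm] at hb
    refine ⟨b, ?_⟩
    have hb' : Tendsto (fun k => (a k : Y)) atTop (𝓝 b) :=
      (continuous_subtype_val.tendsto b).comp hb
    exact (tendsto_iff_of_dist hdist).2 hb'

end CompleteSubset

section InfiniteComposition

variable {Y : Type*} [MetricSpace Y]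

/-- An orbit whose steps are geometrically small fractions of a `1`-Lipschitz function moves a total
distance of at most half the initial value of that function. -/
theorem dist_le_half_of_geometric_steps {η : Y → ℝ} (hη : LipschitzWith 1 η)
    (hnonneg : ∀ x, 0 ≤ η x) {y : ℕ → Y}
    (hy : ∀ j, dist (y j) (y (j + 1)) ≤ η (y j) / 2 ^ (j + 3)) (j : ℕ) :
    dist (y 0) (y j) ≤ η (y 0) / 2 := by
  have key : ∀ j : ℕ, dist (y 0) (y j) ≤ η (y 0) / 2 * (1 - 1 / 2 ^ j) := by
    intro j
    induction j with
    | zero => simp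
    | succ j ih =>
      have h0 := hnonneg (y 0)
      have hp : (0 : ℝ) < 1 / 2 ^ j := by positivity
      have h1 : η (y j) ≤ η (y 0) + dist (y j) (y 0) := by
        simpa using hη.le_add_mul (y j) (y 0)
      rw [dist_comm (y j)] at h1
      have h2 : η (y j) ≤ 2 * η (y 0) := by nlinarith
      have h3 : η (y j) / 2 ^ (j + 3) ≤ 2 * η (y 0) / 2 ^ (j + 3) := by gcongr
      have h4 : 2 * η (y 0) / 2 ^ (j + 3) = η (y 0) / 4 * (1 / 2 ^ j) := by
        field_simp
        ring
      have h5 : (1 : ℝ) / 2 ^ (j + 1) = 1 / 2 ^ j / 2 := by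
        field_simp
        ring
      rw [h5]
      linarith [dist_triangle (y 0) (y j) (y (j + 1)), hy j]
  refine (key j).trans ?_
  have : (0 : ℝ) < 1 / 2 ^ j := by positivity
  nlinarith [hnonneg (y 0)]

end InfiniteComposition

/-- A topologically complete closed countable union of strong `Z`-sets in a metric ANR is a strong
`Z`-set. -/
theorem IsANR.isStrongZSet_iUnion {Y : Type u} [MetricSpace Y] (hY : IsANR Y) {A : Set Y}
    (hA : IsClosed A)
    (hcomplete : ∃ m : MetricSpace ↥A,
      m.toUniformSpace.toTopologicalSpace = (inferInstance : TopologicalSpace ↥A) ∧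
        @CompleteSpace ↥A m.toUniformSpace)
    {Z : ℕ → Set Y} (hZ : ∀ n, IsStrongZSet (Z n)) (hAZ : A = ⋃ n, Z n) :
    IsStrongZSet A := by
  refine ⟨hA, fun 𝒰 h𝒰o h𝒰 => ?_⟩
  obtain ⟨ε, hεL, hε0, hε1, hεU, hεpos⟩ := exists_lipschitz_lebesgue_function 𝒰
  have hεpos' : ∀ y, 0 < ε y := fun y => by
    obtain ⟨U, hU, hy⟩ := mem_sUnion.1 (h𝒰.symm ▸ mem_univ y)
    exact hεpos U hU (h𝒰o U hU) y hy
  obtain ⟨𝒪, h𝒪o, h𝒪A, h𝒪⟩ := exists_covers_tendsto_of_complete hcomplete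
  choose δ hδL hδ0 _ hδO hδpos using fun n => exists_lipschitz_lebesgue_function (𝒪 n)
  have hδA : ∀ n, ∀ a ∈ A, 0 < δ n a := fun n a ha => by
    obtain ⟨O, hO, haO⟩ := h𝒪A n ha
    exact hδpos n O hO (h𝒪o n O hO) a haO
  -- Controls: Lipschitz functions that bound the moves and are positive on `A`.
  let Control := {θ : Y → ℝ // LipschitzWith 1 θ ∧ (∀ y, 0 ≤ θ y) ∧ ∀ a ∈ A, 0 < θ a}
  have hmin : ∀ {θ η : Y → ℝ}, LipschitzWith 1 θ → LipschitzWith 1 η →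
      LipschitzWith 1 fun y => min (θ y) (η y) := fun h h' => by simpa using h.min h'
  have hpush : ∀ (k : ℕ) (θ : Control), ∃ (g : Y → Y) (γ : Y → ℝ), Continuous g ∧
      (∀ y, dist (g y) y ≤ θ.1 y / 2 ^ (k + 3)) ∧ LipschitzWith 1 γ ∧ (∀ y, 0 < γ y) ∧
        closure {w | ∃ y, dist (g y) w ≤ γ (g y) / 2} ∩ Z k = ∅ := fun k θ =>
    (hZ k).exists_dist_le_stable hY (θ.2.1.continuous.div_const _)
      (fun y => div_nonneg (θ.2.2.1 y) (by positivity)) fun z hz =>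
        div_pos (θ.2.2.2 z (hAZ ▸ mem_iUnion_of_mem k hz)) (by positivity)
  choose F Γ hFc hFd hΓL hΓpos hFZ using hpush
  let θ : ℕ → Control := fun n => Nat.rec
    ⟨fun y => min (ε y) (δ 0 y), hmin hεL (hδL 0), fun y => le_min (hε0 y) (hδ0 0 y),
      fun a ha => lt_min (hεpos' a) (hδA 0 a ha)⟩
    (fun k t => ⟨fun y => min (min (t.1 y) (Γ k t y)) (δ (k + 1) y),
      hmin (hmin t.2.1 (hΓL k t)) (hδL (k + 1)),
      fun y => le_min (le_min (t.2.2.1 y) (hΓpos k t y).le) (hδ0 (k + 1) y),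
      fun a ha => lt_min (lt_min (t.2.2.2 a ha) (hΓpos k t a)) (hδA (k + 1) a ha)⟩) n
  have hθsucc : ∀ k y, (θ (k + 1)).1 y =
    min (min ((θ k).1 y) (Γ k (θ k) y)) (δ (k + 1) y) := fun _ _ => rfl
  have hθanti : ∀ {m k}, m ≤ k → ∀ y, (θ k).1 y ≤ (θ m).1 y := fun {m k} hmk y => by
    induction k, hmk using Nat.le_induction with
    | base => exact le_rfl
    | succ k _ ih =>
      rw [hθsucc]
      exact ((min_le_left _ _).trans (min_le_left _ _)).trans ih
  have hθε : ∀ k y, (θ k).1 y ≤ ε y := fun k y =>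
    (hθanti k.zero_le y).trans (min_le_left _ _)
  have hθδ : ∀ {m k}, m ≤ k → ∀ y, (θ k).1 y ≤ δ m y := fun {m k} hmk y => by
    refine (hθanti hmk y).trans ?_
    cases m with
    | zero => exact min_le_right _ _
    | succ m => exact min_le_right _ _
  have hθΓ : ∀ {m k}, m + 1 ≤ k → ∀ y, (θ k).1 y ≤ Γ m (θ m) y := fun {m k} hmk y =>
    (hθanti hmk y).trans ((min_le_left _ _).trans (min_le_right _ _))
  let G : ℕ → Y → Y := fun n => Nat.rec id (fun k g => F k (θ k) ∘ g) n
  have hGsucc : ∀ k y, G (k + 1) y = F k (θ k) (G k y) := fun _ _ => rfl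
  have hGc : ∀ k, Continuous (G k) := fun k => by
    induction k with
    | zero => exact continuous_id
    | succ k ih => exact (hFc k (θ k)).comp ih
  have hGd : ∀ k y, dist (G k y) (G (k + 1) y) ≤ (θ k).1 (G k y) / 2 ^ (k + 3) := fun k y => by
    rw [hGsucc, dist_comm]
    exact hFd k (θ k) (G k y)
  have hdrift : ∀ (η : Y → ℝ), LipschitzWith 1 η → (∀ x, 0 ≤ η x) → ∀ m,
      (∀ k, m ≤ k → ∀ x, (θ k).1 x ≤ η x) → ∀ k, m ≤ k → ∀ y,
        dist (G m y) (G k y) ≤ η (G m y) / 2 := by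
    intro η hη hη0 m hm k hmk y
    obtain ⟨j, rfl⟩ := Nat.exists_eq_add_of_le hmk
    refine dist_le_half_of_geometric_steps hη hη0 (y := fun j => G (m + j) y) (fun j => ?_) j
    refine (hGd (m + j) y).trans ?_
    refine div_le_div₀ (hη0 _) (hm _ (Nat.le_add_right m j) _) (by positivity) ?_
    exact pow_le_pow_right₀ one_le_two (by omega)
  have hconv : ∀ y, ∃ a, Tendsto (fun k => G k y) atTop (𝓝 a) := by
    intro y
    by_cases hstat : ∃ n, ∀ k ≥ n, (θ k).1 (G k y) ≤ 0
    · obtain ⟨n, hn⟩ := hstat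
      refine ⟨G n y, tendsto_const_nhds.congr' ?_⟩
      filter_upwards [eventually_ge_atTop n] with k hk
      induction k, hk using Nat.le_induction with
      | base => rfl
      | succ k hk ih =>
        rw [ih]
        refine dist_le_zero.1 ((hGd k y).trans ?_)
        exact div_nonpos_of_nonpos_of_nonneg (hn k hk) (by positivity)
    · push Not at hstat
      refine h𝒪 _ fun n => ?_
      obtain ⟨k, hnk, hk⟩ := hstat n
      have hδk : 0 < δ n (G k y) := hk.trans_le (hθδ hnk _)
      obtain ⟨O, hO, hball⟩ := hδO n _ hδk
      refine ⟨O, hO, δ n (G k y) / 2, half_pos hδk, ?_⟩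
      filter_upwards [eventually_ge_atTop k] with i hi
      refine (ball_subset_ball' ?_).trans hball
      have := hdrift (δ n) (hδL n) (hδ0 n) k (fun i hi => hθδ (hnk.trans hi)) i hi y
      rw [dist_comm]
      linarith
  choose g hg using hconv
  have hdriftlim : ∀ (η : Y → ℝ), LipschitzWith 1 η → (∀ x, 0 ≤ η x) → ∀ m,
      (∀ k, m ≤ k → ∀ x, (θ k).1 x ≤ η x) → ∀ y, dist (G m y) (g y) ≤ η (G m y) / 2 := by
    intro η hη hη0 m hm y
    refine le_of_tendsto (tendsto_const_nhds.dist (hg y)) ?_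
    filter_upwards [eventually_ge_atTop m] with k hk
    exact hdrift η hη hη0 m hm k hk y
  refine ⟨g, ?_, fun y => ?_, ?_⟩
  · have hunif : TendstoUniformly G g atTop := by
      refine Metric.tendstoUniformly_iff.2 fun r hr => ?_
      have hlim : Tendsto (fun n : ℕ => (1 : ℝ) / 2 ^ n) atTop (𝓝 0) := by
        simpa using tendsto_pow_atTop_nhds_zero_of_lt_one (r := (1 / 2 : ℝ)) (by norm_num)
          (by norm_num)
      filter_upwards [hlim.eventually_lt_const hr] with n hn y
      rw [dist_comm]
      refine (dist_le_of_le_geometric_two_of_tendsto (C := 1) (f := fun k => G k y)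
        (fun k => ?_) (hg y) n).trans_lt hn
      refine (hGd k y).trans ?_
      rw [div_div, ← pow_succ']
      refine div_le_div₀ zero_le_one ((hθε k _).trans (hε1 _)) (by positivity) ?_
      exact pow_le_pow_right₀ one_le_two (by omega)
    exact hunif.continuous (Frequently.of_forall hGc)
  · obtain ⟨U, hU, hball⟩ := hεU y (hεpos' y)
    refine ⟨U, hU, hball (mem_ball_self (hεpos' y)), hball ?_⟩
    have h : dist y (g y) ≤ ε y / 2 := hdriftlim ε hεL hε0 0 (fun k _ => hθε k) y
    rw [mem_ball, dist_comm]
    linarith [hεpos' y]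
  · refine eq_empty_of_forall_notMem fun a ⟨hag, haA⟩ => ?_
    rw [hAZ] at haA
    obtain ⟨m, ham⟩ := mem_iUnion.1 haA
    have hsub : range g ⊆ {w | ∃ y, dist (F m (θ m) y) w ≤ Γ m (θ m) (F m (θ m) y) / 2} := by
      rintro _ ⟨y, rfl⟩
      exact ⟨G m y, hdriftlim _ (hΓL m (θ m)) (fun x => (hΓpos m (θ m) x).le) (m + 1)
        (fun k hk => hθΓ hk) y⟩
    have : a ∈ (∅ : Set Y) := hFZ m (θ m) ▸ ⟨closure_mono hsub hag, ham⟩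
    exact this

/-- (Curtis) Let `A` be a topologically complete (completely metrizable) closed subset of
a metrizable ANR `Y`.  If `A` is a countable union of strong `Z`-sets in `Y`, then `A` is
itself a strong `Z`-set in `Y`. -/
theorem isStrongZSet_of_iUnion_strongZSet (Y : Type u) [TopologicalSpace Y]
    [TopologicalSpace.MetrizableSpace Y] (hY : IsANR Y) (A : Set Y) (hA : IsClosed A)
    (hcomplete : ∃ m : MetricSpace ↥A,
      m.toUniformSpace.toTopologicalSpace = (inferInstance : TopologicalSpace ↥A) ∧
        @CompleteSpace ↥A m.toUniformSpace)
    (hunion : ∃ Z : ℕ → Set Y, (∀ n, IsStrongZSet (Z n)) ∧ A = ⋃ n, Z n) :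
    IsStrongZSet A := by
  let _ : MetricSpace Y := metrizableSpaceMetric Y
  obtain ⟨Z, hZ, hAZ⟩ := hunion
  exact hY.isStrongZSet_iUnion hA hcomplete hZ hAZ
end
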